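/- arXiv:math/0607191 — 2 statements merged into one kernel-verified Lean document; each statement's English description precedes it below -/
import Mathlib

section
/- Let X = (Pⁿ)^k with k ≥ 3 and n ≥ 1, and set s_k = ⌊(n+1)^k / (nk+1)⌋ and δ_k ∈ {0,…,n} with δ_k ≡ s_k (mod n+1). (i) If s ≤ s_k − δ_k, then the s-secant variety of X has the expected dimension: T(n,…,n; s; 0,…,0) holds, i.e. there exist s points p₁,…,p_s (pure tensors of nonzero vectors in (K^{n+1})^{⊗k}) with dim(Σ_j T_{p_j}) = s(nk + 1). (ii) If s ≥ s_k − δ_k + n + 1, then σ_s(X) fills the ambient space: there exist s points p₁,…,p_s with Σ_j T_{p_j} = (K^{n+1})^{⊗k}, of dimension (n+1)^k. -/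
open scoped TensorProduct

/-- The subspace `G^i_p = v₁ ⊗ ⋯ ⊗ v_{i-1} ⊗ Vᵢ ⊗ v_{i+1} ⊗ ⋯ ⊗ v_k` of the tensor
space `⨂ᵢ K^{nᵢ+1}` attached to the point `p = v₁ ⊗ ⋯ ⊗ v_k`. -/
noncomputable def segreG (K : Type*) [Field K] {k : ℕ} (n : Fin k → ℕ)
    (v : ∀ i, Fin (n i + 1) → K) (i : Fin k) :
    Submodule K (⨂[K] i, (Fin (n i + 1) → K)) :=
  LinearMap.range ((PiTensorProduct.tprod K).toLinearMap v i)

/-- The affine tangent space `T_p = Σᵢ v₁ ⊗ ⋯ ⊗ Vᵢ ⊗ ⋯ ⊗ v_k` to the Segre variety at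
`p = v₁ ⊗ ⋯ ⊗ v_k`. -/
noncomputable def segreTangent (K : Type*) [Field K] {k : ℕ} (n : Fin k → ℕ)
    (v : ∀ i, Fin (n i + 1) → K) : Submodule K (⨂[K] i, (Fin (n i + 1) → K)) :=
  ⨆ i, segreG K n v i

/-- The statement `T(n₁,…,n_k; s; a₁,…,a_k)` of Abo–Ottaviani–Peterson holds:
there are points `p₁,…,p_s` and `q_{i,1},…,q_{i,aᵢ}` (pure tensors of nonzero vectors)
such that the span of the tangent spaces `T_{p_j}` together with the subspaces
`G^i_{q_{i,l}}` has the expected (maximal possible) dimension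
`min (s(1 + Σ nᵢ) + Σ aᵢ(nᵢ+1)) (Π (nᵢ+1))`. -/
def THolds (K : Type*) [Field K] {k : ℕ} (n : Fin k → ℕ) (s : ℕ) (a : Fin k → ℕ) : Prop :=
  ∃ (p : Fin s → ∀ i, Fin (n i + 1) → K)
    (q : ∀ i : Fin k, Fin (a i) → ∀ j, Fin (n j + 1) → K),
    (∀ j i, p j i ≠ 0) ∧ (∀ i l j, q i l j ≠ 0) ∧
    Module.finrank K
      (((⨆ j, segreTangent K n (p j)) ⊔ (⨆ i, ⨆ l, segreG K n (q i l) i))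
        : Submodule K (⨂[K] i, (Fin (n i + 1) → K)))
      = min (s * (1 + ∑ i, n i) + ∑ i, a i * (n i + 1)) (∏ i, (n i + 1))

/-- The statement `T(n₁,…,n_k; s; a₁,…,a_k)` fails: every choice of points gives a span
of dimension strictly smaller than the expected dimension. -/
def TFails (K : Type*) [Field K] {k : ℕ} (n : Fin k → ℕ) (s : ℕ) (a : Fin k → ℕ) : Prop :=
  ∀ (p : Fin s → ∀ i, Fin (n i + 1) → K)
    (q : ∀ i : Fin k, Fin (a i) → ∀ j, Fin (n j + 1) → K),
    (∀ j i, p j i ≠ 0) → (∀ i l j, q i l j ≠ 0) →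
    Module.finrank K
      (((⨆ j, segreTangent K n (p j)) ⊔ (⨆ i, ⨆ l, segreG K n (q i l) i))
        : Submodule K (⨂[K] i, (Fin (n i + 1) → K)))
      < min (s * (1 + ∑ i, n i) + ∑ i, a i * (n i + 1)) (∏ i, (n i + 1))

/-- The tuple `(n; s; a)` is subabundant. -/
def Subabundant {k : ℕ} (n : Fin k → ℕ) (s : ℕ) (a : Fin k → ℕ) : Prop :=
  s * (1 + ∑ i, n i) + ∑ i, a i * (n i + 1) ≤ ∏ i, (n i + 1)

/-- The tuple `(n; s; a)` is superabundant. -/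
def Superabundant {k : ℕ} (n : Fin k → ℕ) (s : ℕ) (a : Fin k → ℕ) : Prop :=
  ∏ i, (n i + 1) ≤ s * (1 + ∑ i, n i) + ∑ i, a i * (n i + 1)

namespace SegreSecant

open Module Polynomial

section LineOpen

variable {K : Type*} [Field K]

/-- A function `K → K` which is given by evaluating a polynomial. -/
def IsPolynomialFun (φ : K → K) : Prop := ∃ P : K[X], ∀ t, φ t = P.eval t

namespace IsPolynomialFun

lemma const (c : K) : IsPolynomialFun fun _ : K => c := ⟨C c, by simp⟩

protected lemma id : IsPolynomialFun fun t : K => t := ⟨X, by simp⟩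

lemma add {φ ψ : K → K} (hφ : IsPolynomialFun φ) (hψ : IsPolynomialFun ψ) :
    IsPolynomialFun fun t => φ t + ψ t := by
  obtain ⟨P, hP⟩ := hφ
  obtain ⟨Q, hQ⟩ := hψ
  exact ⟨P + Q, fun t => by simp [hP, hQ]⟩

lemma mul {φ ψ : K → K} (hφ : IsPolynomialFun φ) (hψ : IsPolynomialFun ψ) :
    IsPolynomialFun fun t => φ t * ψ t := by
  obtain ⟨P, hP⟩ := hφ
  obtain ⟨Q, hQ⟩ := hψ
  exact ⟨P * Q, fun t => by simp [hP, hQ]⟩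

lemma sum {ι : Type*} (s : Finset ι) {φ : ι → K → K} (h : ∀ i, IsPolynomialFun (φ i)) :
    IsPolynomialFun fun t => ∑ i ∈ s, φ i t := by
  choose P hP using h
  exact ⟨∑ i ∈ s, P i, fun t => by simp [hP, eval_finsetSum]⟩

lemma det {ι : Type*} [Fintype ι] [DecidableEq ι] {A : K → Matrix ι ι K}
    (h : ∀ i j, IsPolynomialFun fun t => A t i j) : IsPolynomialFun fun t => (A t).det := by
  choose P hP using h
  refine ⟨(Matrix.of P).det, fun t => ?_⟩
  rw [← coe_evalRingHom, RingHom.map_det]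
  exact congrArg Matrix.det (Matrix.ext fun i j => by simp [hP])

lemma finite_zeros {φ : K → K} (h : IsPolynomialFun φ) {t₀ : K} (h₀ : φ t₀ ≠ 0) :
    {t | φ t = 0}.Finite := by
  obtain ⟨P, hP⟩ := h
  have hP0 : P ≠ 0 := by
    rintro rfl
    exact h₀ (by simp [hP])
  refine (P.finite_setOfPred_isRoot hP0).subset fun t ht => ?_
  simpa [IsRoot, hP] using ht

lemma multilinearMap {ι : Type*} [Finite ι] {M : ι → Type*} [∀ i, AddCommGroup (M i)]
    [∀ i, Module K (M i)] (f : MultilinearMap K M K) (u v : ∀ i, M i) :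
    IsPolynomialFun fun t => f (u + t • v) := by
  classical
  cases nonempty_fintype ι
  have h : ∀ t, f (u + t • v) = ∑ s : Finset ι, t ^ sᶜ.card * f (s.piecewise u v) := by
    intro t
    rw [f.map_add_univ]
    refine Finset.sum_congr rfl fun s _ => ?_
    have h1 : s.piecewise u (t • v)
        = sᶜ.piecewise (fun i => t • s.piecewise u v i) (s.piecewise u v) := by
      ext i
      by_cases hi : i ∈ s <;> simp [hi]
    rw [h1, f.map_piecewise_smul (fun _ => t), smul_eq_mul, Finset.prod_const]
  simp only [h]
  exact .sum _ fun s => .mul ⟨X ^ sᶜ.card, by simp⟩ (.const _)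

end IsPolynomialFun

/-- The dimension of the common kernel of a family of functionals depending polynomially on a
parameter can only jump up at finitely many parameters. -/
lemma finite_setOf_lt_finrank {G J : Type*} [AddCommGroup G] [Module K G] [FiniteDimensional K G]
    [Finite J] (φ : K → J → Dual K G) (hφ : ∀ j g, IsPolynomialFun fun t => φ t j g)
    (A : K → Submodule K G) (hA : ∀ t g, g ∈ A t ↔ ∀ j, φ t j g = 0) :
    {t | ¬ finrank K (A t) ≤ finrank K (A 0)}.Finite := by
  classical
  cases nonempty_fintype J
  have hker : ∀ t, A t = LinearMap.ker (LinearMap.pi (φ t)) := by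
    intro t
    ext g
    simp [hA, funext_iff]
  obtain ⟨U, hU⟩ := Submodule.exists_isCompl (A 0)
  have hinj : LinearMap.ker ((LinearMap.pi (φ 0)) ∘ₗ U.subtype) = ⊥ := by
    rw [LinearMap.ker_comp, ← hker, ← Submodule.disjoint_iff_comap_eq_bot]
    exact hU.symm.disjoint
  obtain ⟨L, hL⟩ := LinearMap.exists_leftInverse_of_injective _ hinj
  let b := Module.finBasis K U
  let D : K → K := fun t =>
    (LinearMap.toMatrix b b (L ∘ₗ (LinearMap.pi (φ t)) ∘ₗ U.subtype)).det
  have hD : IsPolynomialFun D := by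
    refine .det fun i j => ?_
    have : ∀ t, LinearMap.toMatrix b b (L ∘ₗ (LinearMap.pi (φ t)) ∘ₗ U.subtype) i j
        = ∑ l : J, φ t l (b j) * b.repr (L fun j => if l = j then 1 else 0) i := by
      intro t
      rw [LinearMap.toMatrix_apply, LinearMap.comp_apply,
        LinearMap.pi_apply_eq_sum_univ L]
      simp
    simp only [this]
    exact .sum _ fun l => .mul (hφ _ _) (.const _)
  have hD0 : D 0 ≠ 0 := by
    simp [D, hL]
  refine (hD.finite_zeros hD0).subset fun t ht => ?_
  by_contra hne
  refine ht ?_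
  have hdisj : U ⊓ A t = ⊥ := by
    rw [eq_bot_iff]
    rintro g ⟨hgU, hgA⟩
    have hdet : LinearMap.det (L ∘ₗ (LinearMap.pi (φ t)) ∘ₗ U.subtype) ≠ 0 := by
      rw [← LinearMap.det_toMatrix b]
      exact hne
    have hk : LinearMap.ker (L ∘ₗ (LinearMap.pi (φ t)) ∘ₗ U.subtype) = ⊥ := by
      by_contra hk
      exact hdet (LinearMap.det_eq_zero_iff_ker_ne_bot.2 hk)
    have hmem : (⟨g, hgU⟩ : U) ∈ LinearMap.ker (L ∘ₗ (LinearMap.pi (φ t)) ∘ₗ U.subtype) := by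
      rw [hker] at hgA
      simp [LinearMap.mem_ker.1 hgA]
    rw [hk] at hmem
    simpa using congrArg Subtype.val ((Submodule.mem_bot K).1 hmem)
  have h1 := Submodule.finrank_sup_add_finrank_inf_eq U (A t)
  have h2 := Submodule.finrank_add_eq_of_isCompl hU
  have h3 := Submodule.finrank_le (U ⊔ A t)
  rw [hdisj, finrank_bot] at h1
  omega

/-- A property of the points of a vector space which, once it holds at a point, holds at all but
finitely many points of every line through this point. -/
def LineOpen {E : Type*} [AddCommGroup E] [Module K E] (P : E → Prop) : Prop :=
  ∀ x d : E, P x → {t : K | ¬ P (x + t • d)}.Finite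

lemma exists_forall_of_lineOpen [Infinite K] {E ι : Type*} [AddCommGroup E] [Module K E]
    [Finite ι] (P : ι → E → Prop) (hP : ∀ i, LineOpen (K := K) (P i)) (h : ∀ i, ∃ x, P i x) :
    ∃ x, ∀ i, P i x := by
  classical
  cases nonempty_fintype ι
  suffices ∀ s : Finset ι, ∃ x, ∀ i ∈ s, P i x by simpa using this Finset.univ
  intro s
  induction s using Finset.induction_on with
  | empty => exact ⟨0, by simp⟩
  | insert a s _ ih =>
    obtain ⟨x, hx⟩ := ih
    obtain ⟨y, hy⟩ := h a
    have h1 : (⋃ i ∈ s, {t : K | ¬ P i (x + t • (y - x))}).Finite :=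
      s.finite_toSet.biUnion fun i hi => hP i x (y - x) (hx i hi)
    have h2 : {t : K | ¬ P a (x + t • (y - x))}.Finite := by
      refine ((hP a y (x - y) hy).preimage
        (f := fun t : K => 1 - t) (sub_right_injective.injOn)).subset fun t ht => ?_
      have : y + (1 - t) • (x - y) = x + t • (y - x) := by module
      simpa [this] using ht
    obtain ⟨t, ht⟩ := (h1.union h2).exists_notMem
    simp only [Set.mem_union, Set.mem_iUnion, Set.mem_ofPred_eq, not_or, not_exists,
      not_not] at ht
    refine ⟨x + t • (y - x), fun i hi => ?_⟩
    rcases Finset.mem_insert.1 hi with rfl | hi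
    · exact ht.2
    · exact ht.1 i hi

end LineOpen

section Pieces

variable {K V : Type*} [Field K] [AddCommGroup V] [Module K V]

variable (K V) in
/-- The multilinear forms of degree `k` on `V`, i.e. the dual of the tensor power. -/
abbrev Form (k : ℕ) := MultilinearMap K (fun _ : Fin k => V) K

/-- The forms vanishing on the tangent spaces of the Segre variety at the points `p s`. -/
def tangentAnn {S : Type*} {k : ℕ} (p : S → Fin k → V) : Submodule K (Form K V k) where
  carrier := {f | ∀ s i w, f (Function.update (p s) i w) = 0}
  add_mem' hf hg s i w := by simp [hf s i w, hg s i w]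
  zero_mem' s i w := by simp
  smul_mem' c f hf s i w := by simp [hf s i w]

lemma mem_tangentAnn {S : Type*} {k : ℕ} {p : S → Fin k → V} {f : Form K V k} :
    f ∈ tangentAnn p ↔ ∀ s i w, f (Function.update (p s) i w) = 0 := Iff.rfl

/-- The `d`-tuples of forms which vanish at the points `q x` and `r y`, and for which the
combination with coefficients `γ x` vanishes on the tangent space at `q x`. -/
def pieceAnn {X Y : Type*} {d k : ℕ} (γ : X → Fin d → K) (q : X → Fin k → V)
    (r : Y → Fin k → V) : Submodule K (Fin d → Form K V k) where
  carrier := {g | (∀ x c, g c (q x) = 0) ∧ (∀ y c, g c (r y) = 0) ∧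
    ∀ x i w, ∑ c, γ x c * g c (Function.update (q x) i w) = 0}
  add_mem' hf hg := by
    refine ⟨fun x c => ?_, fun y c => ?_, fun x i w => ?_⟩
    · simp [hf.1 x c, hg.1 x c]
    · simp [hf.2.1 y c, hg.2.1 y c]
    · simp [mul_add, Finset.sum_add_distrib, hf.2.2 x i w, hg.2.2 x i w]
  zero_mem' := by simp
  smul_mem' a f hf := by
    refine ⟨fun x c => ?_, fun y c => ?_, fun x i w => ?_⟩
    · simp [hf.1 x c]
    · simp [hf.2.1 y c]
    · simp [mul_left_comm _ a, ← Finset.mul_sum, hf.2.2 x i w]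

lemma mem_pieceAnn {X Y : Type*} {d k : ℕ} {γ : X → Fin d → K} {q : X → Fin k → V}
    {r : Y → Fin k → V} {g : Fin d → Form K V k} :
    g ∈ pieceAnn γ q r ↔ (∀ x c, g c (q x) = 0) ∧ (∀ y c, g c (r y) = 0) ∧
      ∀ x i w, ∑ c, γ x c * g c (Function.update (q x) i w) = 0 := Iff.rfl

variable (K V) in
/-- There are `s` points whose tangent spaces span a subspace of codimension at most `e`. -/
def CorankLE (k s e : ℕ) : Prop :=
  ∃ p : Fin s → Fin k → V, finrank K (tangentAnn (K := K) p) ≤ e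

variable (K V) in
/-- There are `x` tangent directions and `y` points for which the space of annihilating
`d`-tuples has dimension at most `e`. -/
def PieceCorankLE (d k x y e : ℕ) : Prop :=
  ∃ (γ : Fin x → Fin d → K) (q : Fin x → Fin k → V) (r : Fin y → Fin k → V),
    finrank K (pieceAnn γ q r) ≤ e

lemma pieceAnn_reindex {X Y X' Y' : Type*} {d k : ℕ} (e : X ≃ X') (e' : Y ≃ Y')
    (γ : X' → Fin d → K) (q : X' → Fin k → V) (r : Y' → Fin k → V) :
    pieceAnn (γ ∘ e) (q ∘ e) (r ∘ e') = pieceAnn γ q r := by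
  ext g
  simp [mem_pieceAnn, e.forall_congr_left, e'.forall_congr_left]

lemma pieceCorankLE_iff {X Y : Type*} [Fintype X] [Fintype Y] {d k x y e : ℕ}
    (hx : Fintype.card X = x) (hy : Fintype.card Y = y) :
    PieceCorankLE K V d k x y e ↔ ∃ (γ : X → Fin d → K) (q : X → Fin k → V)
      (r : Y → Fin k → V), finrank K (pieceAnn γ q r) ≤ e := by
  let a := Fintype.equivFinOfCardEq hx
  let b := Fintype.equivFinOfCardEq hy
  constructor
  · rintro ⟨γ, q, r, h⟩
    exact ⟨γ ∘ a, q ∘ a, r ∘ b, by rwa [pieceAnn_reindex]⟩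
  · rintro ⟨γ, q, r, h⟩
    exact ⟨γ ∘ a.symm, q ∘ a.symm, r ∘ b.symm, by rwa [pieceAnn_reindex]⟩

lemma LineOpen.comp {E F : Type*} [AddCommGroup E] [Module K E] [AddCommGroup F] [Module K F]
    {P : F → Prop} (hP : LineOpen (K := K) P) (f : E → F)
    (hf : ∀ x d (t : K), f (x + t • d) = f x + t • f d) :
    LineOpen (K := K) fun x => P (f x) := by
  intro x d hx
  simpa only [hf] using hP (f x) (f d) hx

lemma lineOpen_finrank_pieceAnn [FiniteDimensional K V] {X Y : Type*} [Finite X] [Finite Y]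
    (d k e : ℕ) :
    LineOpen (K := K) fun ε : (X → Fin d → K) × (X → Fin k → V) × (Y → Fin k → V) =>
      finrank K (pieceAnn ε.1 ε.2.1 ε.2.2) ≤ e := by
  intro ε δ hε
  let b := Module.finBasis K V
  let φ : K → (Y × Fin d) ⊕ (X × Fin d) ⊕ (X × Fin k × Fin (finrank K V)) →
      Dual K (Fin d → Form K V k) := fun t j => match j with
    | .inl (y, c) =>
      { toFun g := g c (ε.2.2 y + t • δ.2.2 y)
        map_add' _ _ := by simp
        map_smul' _ _ := by simp }
    | .inr (.inl (x, c)) =>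
      { toFun g := g c (ε.2.1 x + t • δ.2.1 x)
        map_add' _ _ := by simp
        map_smul' _ _ := by simp }
    | .inr (.inr (x, i, l)) =>
      { toFun g := ∑ c, (ε.1 x c + t * δ.1 x c) *
          g c (Function.update (ε.2.1 x) i (b l) + t • Function.update (δ.2.1 x) i 0)
        map_add' _ _ := by simp [mul_add, Finset.sum_add_distrib]
        map_smul' a _ := by simp [mul_left_comm _ a, ← Finset.mul_sum] }
  have hφ : ∀ j g, IsPolynomialFun fun t : K => φ t j g := by
    rintro (⟨y, c⟩ | ⟨x, c⟩ | ⟨x, i, l⟩) g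
    · exact .multilinearMap _ _ _
    · exact .multilinearMap _ _ _
    · change IsPolynomialFun fun t => ∑ c, (ε.1 x c + t * δ.1 x c) *
        g c (Function.update (ε.2.1 x) i (b l) + t • Function.update (δ.2.1 x) i 0)
      exact .sum _ fun c => .mul (.add (.const (ε.1 x c)) (.mul .id (.const (δ.1 x c))))
        (.multilinearMap (g c) _ _)
  let A : K → Submodule K (Fin d → Form K V k) := fun t =>
    pieceAnn (ε + t • δ).1 (ε + t • δ).2.1 (ε + t • δ).2.2
  have hA0 : A 0 = pieceAnn ε.1 ε.2.1 ε.2.2 := by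
    have h0 : ε + (0 : K) • δ = ε := by rw [zero_smul, add_zero]
    simp only [A]
    rw [h0]
  have key := finite_setOf_lt_finrank φ hφ A ?_
  · refine key.subset fun t ht hlt => ht (hlt.trans ?_)
    rwa [hA0]
  · intro t g
    have hup : ∀ x i w, Function.update (ε.2.1 x + t • δ.2.1 x) i w
        = Function.update (ε.2.1 x) i w + t • Function.update (δ.2.1 x) i 0 := by
      intro x i w
      ext j
      by_cases hj : j = i
      · subst hj; simp
      · simp [hj]
    have hlin : ∀ x i, (∀ w, ∑ c, (ε.1 x c + t * δ.1 x c) *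
          g c (Function.update (ε.2.1 x + t • δ.2.1 x) i w) = 0) ↔
        ∀ l, ∑ c, (ε.1 x c + t * δ.1 x c) *
          g c (Function.update (ε.2.1 x + t • δ.2.1 x) i (b l)) = 0 := by
      intro x i
      refine ⟨fun h l => h _, fun h => ?_⟩
      let L : V →ₗ[K] K := ∑ c, (ε.1 x c + t * δ.1 x c) •
        (g c).toLinearMap (ε.2.1 x + t • δ.2.1 x) i
      have hL : L = 0 := b.ext fun l => by simpa [L] using h l
      intro w
      simpa [L] using LinearMap.congr_fun hL w
    simp only [A, mem_pieceAnn]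
    constructor
    · rintro ⟨h1, h2, h3⟩ (⟨y, c⟩ | ⟨x, c⟩ | ⟨x, i, l⟩)
      · exact h2 y c
      · exact h1 x c
      · simpa [φ, hup] using h3 x i (b l)
    · intro h
      refine ⟨fun x c => h (.inr (.inl (x, c))), fun y c => h (.inl (y, c)), fun x i => ?_⟩
      refine (hlin x i).2 fun l => ?_
      rw [hup]
      exact h (.inr (.inr (x, i, l)))

end Pieces

section Monotonicity

variable {K V : Type*} [Field K] [AddCommGroup V] [Module K V]

lemma finrank_le_finrank_inf_add {G : Type*} [AddCommGroup G] [Module K G]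
    [FiniteDimensional K G] (A B : Submodule K G) {d : ℕ} (h : finrank K G ≤ finrank K B + d) :
    finrank K A ≤ finrank K (A ⊓ B : Submodule K G) + d := by
  have h1 := Submodule.finrank_sup_add_finrank_inf_eq A B
  have h2 := Submodule.finrank_le (A ⊔ B)
  omega

lemma finrank_le_finrank_ker_add {G H : Type*} [AddCommGroup G] [Module K G]
    [FiniteDimensional K G] [AddCommGroup H] [Module K H] [FiniteDimensional K H]
    (L : G →ₗ[K] H) : finrank K G ≤ finrank K (LinearMap.ker L) + finrank K H := by
  have h1 := L.finrank_range_add_finrank_ker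
  have h2 := Submodule.finrank_le (LinearMap.range L)
  omega

open Classical in
/-- Replace the zero vectors in a tuple by a fixed vector. -/
noncomputable def replaceZero {k : ℕ} (u : V) (p : Fin k → V) : Fin k → V :=
  fun i => if p i = 0 then u else p i

lemma replaceZero_ne_zero {k : ℕ} {u : V} (hu : u ≠ 0) (p : Fin k → V) (i : Fin k) :
    replaceZero u p i ≠ 0 := by
  unfold replaceZero
  split_ifs with h
  exacts [hu, h]

lemma tangentAnn_replaceZero_le {S : Type*} {k : ℕ} (u : V) (p : S → Fin k → V) :
    tangentAnn (K := K) (fun s => replaceZero u (p s)) ≤ tangentAnn p := by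
  intro f hf s i w
  by_cases h : ∃ j, j ≠ i ∧ p s j = 0
  · obtain ⟨j, hji, hj⟩ := h
    exact f.map_coord_zero j (by simp [hji, hj])
  · push Not at h
    have : Function.update (p s) i w = Function.update (replaceZero u (p s)) i w := by
      ext j
      by_cases hj : j = i
      · subst hj; simp
      · simp [hj, replaceZero, h j hj]
    rw [this]
    exact hf s i w

variable [FiniteDimensional K V]

lemma finrank_form_le_finrank_tangentAnn_add {N : ℕ} (hV : finrank K V = N) (hN : 1 ≤ N) {k : ℕ}
    (p : Fin k → V) :
    finrank K (Form K V k)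
      ≤ finrank K (tangentAnn (K := K) fun _ : Unit => p) + (k * (N - 1) + 1) := by
  have : Nontrivial V := Module.nontrivial_of_finrank_pos (R := K) (by omega)
  obtain ⟨u, hu⟩ := exists_ne (0 : V)
  have hle := Submodule.finrank_mono (tangentAnn_replaceZero_le (K := K) u fun _ : Unit => p)
  suffices h : finrank K (Form K V k) ≤ finrank K (tangentAnn (K := K)
      fun _ : Unit => replaceZero u p) + (k * (N - 1) + 1) by omega
  generalize hq : replaceZero u p = q
  have hq0 : ∀ i, q i ≠ 0 := fun i => hq ▸ replaceZero_ne_zero hu p i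
  choose U hU using fun i => Submodule.exists_isCompl (K ∙ q i)
  have hUr : ∀ i, finrank K (U i) = N - 1 := fun i => by
    have := Submodule.finrank_add_eq_of_isCompl (hU i)
    rw [finrank_span_singleton (hq0 i), hV] at this
    omega
  let L : Form K V k →ₗ[K] K × (∀ i, Dual K (U i)) :=
    { toFun f := (f q, fun i => f.toLinearMap q i ∘ₗ (U i).subtype)
      map_add' f g := by
        ext <;> simp
      map_smul' a f := by
        ext <;> simp }
  have h1 := finrank_le_finrank_ker_add L
  have h2 : LinearMap.ker L ≤ tangentAnn fun _ : Unit => q := by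
    intro f hf _ i w
    have hf' := LinearMap.mem_ker.1 hf
    simp only [L, LinearMap.coe_mk, AddHom.coe_mk, Prod.mk_eq_zero] at hf'
    obtain ⟨a, ha, b, hb, rfl⟩ := Submodule.mem_sup.1
      ((hU i).sup_eq_top ▸ Submodule.mem_top : w ∈ (K ∙ q i) ⊔ U i)
    obtain ⟨c, rfl⟩ := Submodule.mem_span_singleton.1 ha
    have h3 : f (Function.update q i b) = 0 := LinearMap.congr_fun (congrFun hf'.2 i) ⟨b, hb⟩
    rw [f.map_update_add, f.map_update_smul, Function.update_eq_self, hf'.1, h3]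
    simp
  have h3 := Submodule.finrank_mono h2
  have h4 : finrank K (K × (∀ i, Dual K (U i))) = k * (N - 1) + 1 := by
    rw [finrank_prod, finrank_pi_fintype]
    simp [Subspace.dual_finrank_eq, hUr, add_comm]
  omega

lemma finrank_form_le_finrank_tangentAnn_add_mul {N : ℕ} (hV : finrank K V = N) (hN : 1 ≤ N)
    {k s : ℕ} (p : Fin s → Fin k → V) :
    finrank K (Form K V k)
      ≤ finrank K (tangentAnn (K := K) p) + s * (k * (N - 1) + 1) := by
  induction s with
  | zero =>
    have : tangentAnn (K := K) p = ⊤ := by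
      rw [eq_top_iff]
      exact fun f _ s => s.elim0
    rw [this, finrank_top]
    omega
  | succ s ih =>
    have h1 : tangentAnn (K := K) p = tangentAnn (fun i => p (Fin.castSucc i)) ⊓
        tangentAnn (fun _ : Unit => p (Fin.last s)) := by
      ext f
      simp [mem_tangentAnn, Fin.forall_fin_succ']
    have h2 := ih fun i => p (Fin.castSucc i)
    have h3 := finrank_le_finrank_inf_add (tangentAnn (K := K) fun i => p (Fin.castSucc i)) _
      (finrank_form_le_finrank_tangentAnn_add hV hN (p (Fin.last s)))
    rw [h1]
    linarith

lemma CorankLE.mono {k s e s' e' : ℕ} (h : CorankLE K V k s e) (hs : s ≤ s') (he : e ≤ e') :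
    CorankLE K V k s' e' := by
  obtain ⟨p, hp⟩ := h
  refine ⟨fun i => if hi : i < s then p ⟨i, hi⟩ else 0, le_trans ?_ (hp.trans he)⟩
  refine Submodule.finrank_mono fun f hf i => ?_
  have := hf (Fin.castLE hs i)
  simpa using this

lemma CorankLE.of_succ {N : ℕ} (hV : finrank K V = N) (hN : 1 ≤ N) {k s e : ℕ}
    (h : CorankLE K V k (s + 1) e) : CorankLE K V k s (e + (k * (N - 1) + 1)) := by
  obtain ⟨p, hp⟩ := h
  refine ⟨fun i => p (Fin.castSucc i), ?_⟩
  have h1 : tangentAnn (K := K) p = tangentAnn (fun i => p (Fin.castSucc i)) ⊓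
      tangentAnn (fun _ : Unit => p (Fin.last s)) := by
    ext f
    simp [mem_tangentAnn, Fin.forall_fin_succ']
  rw [h1] at hp
  exact (finrank_le_finrank_inf_add _ _
    (finrank_form_le_finrank_tangentAnn_add hV hN (p (Fin.last s)))).trans
    (Nat.add_le_add_right hp _)

lemma CorankLE.of_le {N : ℕ} (hV : finrank K V = N) (hN : 1 ≤ N) {k s s' e : ℕ}
    (h : CorankLE K V k s' e) (hs : s ≤ s') :
    CorankLE K V k s (e + (s' - s) * (k * (N - 1) + 1)) := by
  obtain ⟨j, rfl⟩ := Nat.exists_eq_add_of_le hs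
  induction j generalizing e with
  | zero => simpa using h
  | succ j ih =>
    have := ih (CorankLE.of_succ (e := e) (s := s + j) hV hN h) (by omega)
    convert this using 1
    simp only [Nat.add_sub_cancel_left]
    ring

lemma PieceCorankLE.mono {d k x y e y' e' : ℕ} (h : PieceCorankLE K V d k x y e) (hy : y ≤ y')
    (he : e ≤ e') : PieceCorankLE K V d k x y' e' := by
  obtain ⟨γ, q, r, hp⟩ := h
  refine ⟨γ, q, fun i => if hi : i < y then r ⟨i, hi⟩ else 0, le_trans ?_ (hp.trans he)⟩
  refine Submodule.finrank_mono fun f hf => ⟨hf.1, fun i c => ?_, hf.2.2⟩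
  have := hf.2.1 (Fin.castLE hy i) c
  simpa using this

lemma PieceCorankLE.of_succ {d k x y e : ℕ} (h : PieceCorankLE K V d k x (y + 1) e) :
    PieceCorankLE K V d k x y (e + d) := by
  obtain ⟨γ, q, r, hp⟩ := h
  refine ⟨γ, q, fun i => r (Fin.castSucc i), ?_⟩
  let L : (Fin d → Form K V k) →ₗ[K] (Fin d → K) :=
    { toFun g := fun c => g c (r (Fin.last y))
      map_add' f g := by ext; simp
      map_smul' a f := by ext; simp }
  have h1 : pieceAnn γ q r = pieceAnn γ q (fun i => r (Fin.castSucc i)) ⊓ LinearMap.ker L := by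
    ext f
    simp [mem_pieceAnn, Fin.forall_fin_succ', L, funext_iff]
    tauto
  rw [h1] at hp
  have h2 := finrank_le_finrank_ker_add L
  rw [finrank_pi, Fintype.card_fin] at h2
  exact (finrank_le_finrank_inf_add _ _ h2).trans (Nat.add_le_add_right hp _)

lemma PieceCorankLE.of_le {d k x y y' e : ℕ} (h : PieceCorankLE K V d k x y' e) (hy : y ≤ y') :
    PieceCorankLE K V d k x y (e + d * (y' - y)) := by
  obtain ⟨j, rfl⟩ := Nat.exists_eq_add_of_le hy
  induction j generalizing e with
  | zero => simpa using h
  | succ j ih =>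
    have := ih (PieceCorankLE.of_succ (y := y + j) h) (by omega)
    convert this using 1
    simp only [Nat.add_sub_cancel_left]
    ring

/-- A spanning configuration with `g` points gives configurations with any number of points. -/
lemma PieceCorankLE.change {d k x g : ℕ} (h : PieceCorankLE K V d k x g 0) (y : ℕ) :
    PieceCorankLE K V d k x y (d * (g - y)) := by
  rcases le_total y g with hy | hy
  · simpa using h.of_le hy
  · exact h.mono hy (Nat.zero_le _)

lemma PieceCorankLE.add_point {k x y e : ℕ} (h : PieceCorankLE K V 1 k x y e) :
    PieceCorankLE K V 1 k x (y + 1) (e - 1) := by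
  obtain ⟨γ, q, r, hp⟩ := h
  by_cases h0 : pieceAnn γ q r = ⊥
  · refine PieceCorankLE.mono ⟨γ, q, r, ?_⟩ (Nat.le_succ y) le_rfl
    rw [h0, finrank_bot]
    exact Nat.zero_le _
  · obtain ⟨g, hg, hg0⟩ := Submodule.exists_mem_ne_zero_of_ne_bot h0
    obtain ⟨v, hv⟩ : ∃ v, g 0 v ≠ 0 := by
      by_contra! hv
      refine hg0 (funext fun c => ?_)
      rw [Subsingleton.elim c 0]
      exact MultilinearMap.ext hv
    refine ⟨γ, q, Fin.snoc (α := fun _ => Fin k → V) r v, ?_⟩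
    refine Nat.le_sub_one_of_lt (lt_of_lt_of_le (Submodule.finrank_lt_finrank_of_lt ?_) hp)
    refine lt_of_le_of_ne (fun f hf => ⟨hf.1, fun y c => ?_, hf.2.2⟩) fun heq => hv ?_
    · simpa using hf.2.1 y.castSucc c
    · rw [← heq] at hg
      simpa using hg.2.1 (Fin.last y) 0

lemma CorankLE.piece {k t e : ℕ} (h : CorankLE K V k t e) (y : ℕ) :
    PieceCorankLE K V 1 k t y (e - y) := by
  induction y with
  | zero =>
    obtain ⟨p, hp⟩ := h
    refine ⟨fun _ _ => 1, p, Fin.elim0, le_trans ?_ hp⟩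
    let L : pieceAnn (K := K) (fun _ _ => (1 : K)) p (Fin.elim0 : Fin 0 → Fin k → V) →ₗ[K]
        tangentAnn (K := K) p := LinearMap.codRestrict _
      ((LinearMap.proj (0 : Fin 1)) ∘ₗ Submodule.subtype _) fun g s i w => by
        simpa using g.2.2.2 s i w
    refine LinearMap.finrank_le_finrank_of_injective (f := L) fun g g' hgg => ?_
    refine Subtype.ext (funext fun c => ?_)
    rw [Subsingleton.elim c 0]
    exact congrArg Subtype.val hgg
  | succ y ih => exact ih.add_point.mono le_rfl (by omega)

end Monotonicity

section Split

variable {K : Type*} [Field K]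

lemma corankLE_of_fintype {V S : Type*} [AddCommGroup V] [Module K V] [Fintype S] {k s e : ℕ}
    (hS : Fintype.card S = s) (p : S → Fin k → V) (h : finrank K (tangentAnn (K := K) p) ≤ e) :
    CorankLE K V k s e := by
  let a := Fintype.equivFinOfCardEq hS
  have h1 : tangentAnn (K := K) (p ∘ a.symm) = tangentAnn p := by
    ext f
    simp [mem_tangentAnn, a.symm.forall_congr_left]
  exact ⟨p ∘ a.symm, by rwa [h1]⟩

lemma finrank_le_sum_of_injOn {ι G : Type*} {H : ι → Type*} [Fintype ι] [AddCommGroup G]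
    [Module K G] [∀ l, AddCommGroup (H l)] [∀ l, Module K (H l)]
    [∀ l, FiniteDimensional K (H l)] (A : Submodule K G) (B : ∀ l, Submodule K (H l))
    (L : ∀ l, G →ₗ[K] H l) (hL : ∀ l, ∀ f ∈ A, L l f ∈ B l)
    (hinj : ∀ f ∈ A, (∀ l, L l f = 0) → f = 0) :
    finrank K A ≤ ∑ l, finrank K (B l) := by
  rw [← finrank_pi_fintype]
  let M : A →ₗ[K] ∀ l, B l := LinearMap.pi fun l =>
    LinearMap.codRestrict _ (L l ∘ₗ A.subtype) fun f => hL l f.1 f.2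
  refine LinearMap.finrank_le_finrank_of_injective (f := M) ?_
  refine LinearMap.ker_eq_bot.1 (LinearMap.ker_eq_bot'.2 fun f hf => ?_)
  exact Subtype.ext (hinj f.1 f.2 fun l => congrArg Subtype.val (congrFun hf l))

/-- The restrictions of a form of degree `k + 1` to the slices of a set of basis vectors. -/
def slices {N d k : ℕ} (a : Fin d → Fin N) :
    Form K (Fin N → K) (k + 1) →ₗ[K] Fin d → Form K (Fin N → K) k where
  toFun f := fun c => f.curryLeft (Pi.single (a c) 1)
  map_add' _ _ := by ext; simp
  map_smul' _ _ := by ext; simp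

lemma slices_apply {N d k : ℕ} (a : Fin d → Fin N) (f : Form K (Fin N → K) (k + 1)) (c : Fin d)
    (m : Fin k → Fin N → K) : slices a f c m = f (Fin.cons (Pi.single (a c) 1) m) := rfl

lemma finrank_tangentAnn_le_sum {N k : ℕ} {ι : Type*} [Fintype ι] {d x : ι → ℕ}
    (E : (Σ l, Fin (d l)) ≃ Fin N) (γ : ∀ l, Fin (x l) → Fin (d l) → K)
    (q : ∀ l, Fin (x l) → Fin k → Fin N → K) :
    finrank K (tangentAnn (K := K) fun σ : Σ l, Fin (x l) =>
        (Fin.cons (∑ c, γ σ.1 σ.2 c • Pi.single (E ⟨σ.1, c⟩) 1) (q σ.1 σ.2) :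
          Fin (k + 1) → Fin N → K))
      ≤ ∑ l, finrank K (pieceAnn (γ l) (q l)
          fun σ : {σ : Σ l, Fin (x l) // σ.1 ≠ l} => q σ.1.1 σ.1.2) := by
  refine finrank_le_sum_of_injOn _ _ (fun l => slices fun c => E ⟨l, c⟩) ?_ ?_
  · intro l f hf
    have h0 : ∀ l j c', f (Fin.cons c' (q l j)) = 0 := fun l j c' => by
      have := hf ⟨l, j⟩ 0 c'
      simpa using this
    refine ⟨fun j c => h0 l j _, fun σ c => h0 _ _ _, fun j i w => ?_⟩
    have h1 := hf ⟨l, j⟩ i.succ w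
    simp only [← Fin.cons_update] at h1
    rw [← MultilinearMap.curryLeft_apply, map_sum, sum_apply] at h1
    simpa [slices_apply] using h1
  · intro f _ hf
    have h1 : ∀ i m, f (Fin.cons (Pi.single i 1) m) = 0 := by
      intro i m
      obtain ⟨⟨l, c⟩, rfl⟩ := E.surjective i
      exact congrArg (fun g : Form K (Fin N → K) k => g m) (congrFun (hf l) c)
    have h2 : f.curryLeft = 0 := by
      refine (Pi.basisFun K (Fin N)).ext fun i => ?_
      refine MultilinearMap.ext fun m => ?_
      simpa using h1 i m
    have h3 : f = 0 := by
      refine MultilinearMap.ext fun m => ?_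
      have := congrArg (fun g : (Fin N → K) →ₗ[K] Form K (Fin N → K) k =>
        g (m 0) (Fin.tail m)) h2
      simpa using this
    exact h3

/-- Splitting the first factor: a configuration in degree `k + 1` is assembled from pieces of
degree `k`, where each piece sees the points of the others as simple points. -/
lemma CorankLE.split [Infinite K] {N k : ℕ} {ι : Type*} [Fintype ι] (d x e : ι → ℕ) {s : ℕ}
    (hd : ∑ l, d l = N) (hs : ∑ l, x l = s)
    (h : ∀ l, PieceCorankLE K (Fin N → K) (d l) k (x l) (s - x l) (e l)) :
    CorankLE K (Fin N → K) (k + 1) s (∑ l, e l) := by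
  classical
  let P : ι → ((∀ l, Fin (x l) → Fin (d l) → K) × (∀ l, Fin (x l) → Fin k → Fin N → K)) → Prop :=
    fun l ε => finrank K (pieceAnn (ε.1 l) (ε.2 l)
      fun σ : {σ : Σ l, Fin (x l) // σ.1 ≠ l} => ε.2 σ.1.1 σ.1.2) ≤ e l
  obtain ⟨ε, hε⟩ := exists_forall_of_lineOpen (K := K) P
    (fun l => (lineOpen_finrank_pieceAnn (d l) k (e l)).comp
      (fun ε : (∀ l, Fin (x l) → Fin (d l) → K) × (∀ l, Fin (x l) → Fin k → Fin N → K) =>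
        (ε.1 l, ε.2 l, fun σ : {σ : Σ l, Fin (x l) // σ.1 ≠ l} => ε.2 σ.1.1 σ.1.2))
      fun _ _ _ => rfl)
    (fun l => by
      have hc : Fintype.card {σ : Σ l, Fin (x l) // σ.1 ≠ l} = s - x l := by
        rw [Fintype.card_subtype_compl, Fintype.card_sigma]
        simp only [Fintype.card_fin, hs]
        congr 1
        rw [Fintype.card_congr (Equiv.sigmaSubtype l), Fintype.card_fin]
      obtain ⟨γ, q, r, hp⟩ := (pieceCorankLE_iff (Fintype.card_fin _) hc).1 (h l)
      refine ⟨(Function.update 0 l γ, Function.update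
        (fun l' j => if hl : l' ≠ l then r ⟨⟨l', j⟩, hl⟩ else 0) l q), ?_⟩
      have h1 : (fun σ : {σ : Σ l, Fin (x l) // σ.1 ≠ l} => Function.update
        (fun l' j => if hl : l' ≠ l then r ⟨⟨l', j⟩, hl⟩ else 0) l q σ.1.1 σ.1.2) = r := by
        ext1 ⟨⟨l', j⟩, hl⟩
        simp only [ne_eq] at hl
        simp [hl]
      simp only [P]
      rw [h1]
      refine (congrArg (fun A : Submodule K (Fin (d l) → Form K (Fin N → K) k) =>
        finrank K A ≤ e l) ?_).mpr hp
      rw [Function.update_self, Function.update_self])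
  refine corankLE_of_fintype (S := Σ l, Fin (x l)) (by simp [hs]) _
    ((finrank_tangentAnn_le_sum (Fintype.equivFinOfCardEq (by simp [hd])) ε.1 ε.2).trans
      (Finset.sum_le_sum fun l _ => hε l))

end Split

section Step

variable {K : Type*} [Field K]

variable (K) in
/-- The span of the tangent spaces at `s` general points of the `k`-th power of `Pⁿ` has the
expected dimension. -/
def Nondefective (n k s : ℕ) : Prop :=
  CorankLE K (Fin (n + 1) → K) k s ((n + 1) ^ k - s * (n * k + 1))

variable (K) in
/-- `t (n + 1)` points span a space of the expected dimension and `(t + 1) (n + 1)` points span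
everything, where `t` is the integral part of `(n + 1) ^ (k - 1) / (n * k + 1)`. -/
def AlmostNondefective (n k : ℕ) : Prop :=
  Nondefective K n k ((n + 1) * ((n + 1) ^ (k - 1) / (n * k + 1))) ∧
    CorankLE K (Fin (n + 1) → K) k ((n + 1) * ((n + 1) ^ (k - 1) / (n * k + 1) + 1)) 0

lemma Nondefective.mono {n k s s' : ℕ} (h : Nondefective K n k s)
    (hs : s * (n * k + 1) ≤ (n + 1) ^ k) (hs' : s' ≤ s) : Nondefective K n k s' := by
  refine (CorankLE.of_le (N := n + 1) (by simp) (by omega) h hs').mono le_rfl ?_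
  have h1 : s * (n * k + 1) = s' * (n * k + 1) + (s - s') * (n * k + 1) := by
    rw [← add_mul]
    congr 1
    omega
  have h2 : k * (n + 1 - 1) + 1 = n * k + 1 := by rw [Nat.add_sub_cancel, mul_comm]
  rw [h2]
  omega

lemma CorankLE.step [Infinite K] {N k : ℕ} (t e : Fin N → ℕ) {s : ℕ} (hs : ∑ c, t c = s)
    (h : ∀ c, CorankLE K (Fin N → K) k (t c) (e c)) :
    CorankLE K (Fin N → K) (k + 1) s (∑ c, (e c - (s - t c))) :=
  CorankLE.split (fun _ => 1) t _ (by simp) hs fun c => (h c).piece _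

lemma CorankLE.step_uniform [Infinite K] {N k t e : ℕ} (h : CorankLE K (Fin N → K) k t e) :
    CorankLE K (Fin N → K) (k + 1) (N * t) (N * (e - (N - 1) * t)) := by
  have := CorankLE.step (fun _ => t) (fun _ => e) (s := N * t) (by simp) fun _ => h
  simpa [Nat.sub_mul] using this

lemma Nondefective.step [Infinite K] {n k t : ℕ} (h : Nondefective K n k t) :
    Nondefective K n (k + 1) ((n + 1) * t) := by
  refine CorankLE.mono (CorankLE.step_uniform h) le_rfl (le_of_eq ?_)
  rw [Nat.sub_sub, Nat.mul_sub, ← pow_succ']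
  congr 1
  simp only [Nat.add_sub_cancel]
  ring

lemma Nondefective.corankLE_zero {n k s : ℕ} (h : Nondefective K n k s)
    (hs : (n + 1) ^ k ≤ s * (n * k + 1)) : CorankLE K (Fin (n + 1) → K) k s 0 :=
  CorankLE.mono h le_rfl (by omega)

lemma AlmostNondefective.of_nondefective [Infinite K] {n k m : ℕ} (h : Nondefective K n k m)
    (hm : m * (n * k + 1) ≤ (n + 1) ^ k) (ht : (n + 1) ^ k / (n * (k + 1) + 1) < m) :
    AlmostNondefective K n (k + 1) := by
  rw [AlmostNondefective, Nat.add_sub_cancel]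
  refine ⟨(h.mono hm ht.le).step, (h.mono hm ht).step.corankLE_zero ?_⟩
  have := Nat.lt_mul_div_succ ((n + 1) ^ k) (show 0 < n * (k + 1) + 1 by omega)
  rw [pow_succ', mul_assoc]
  refine Nat.mul_le_mul_left _ ?_
  rw [mul_comm]
  exact this.le

lemma AlmostNondefective.of_eq [Infinite K] {n k m : ℕ} (h : Nondefective K n k m)
    (hm : m * (n * (k + 1) + 1) = (n + 1) ^ k) : AlmostNondefective K n (k + 1) := by
  have ht : (n + 1) ^ k / (n * (k + 1) + 1) = m :=
    Nat.div_eq_of_eq_mul_left (by omega) hm.symm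
  rw [AlmostNondefective, Nat.add_sub_cancel, ht]
  refine ⟨h.step, (h.step.corankLE_zero ?_).mono (Nat.mul_le_mul_left _ (Nat.le_succ m)) le_rfl⟩
  rw [mul_assoc, hm, pow_succ']

lemma mul_pow_div_mul_le {n k : ℕ} (hk : 1 ≤ k) :
    (n + 1) * ((n + 1) ^ (k - 1) / (n * k + 1)) * (n * k + 1) ≤ (n + 1) ^ k := by
  rw [mul_assoc]
  refine (Nat.mul_le_mul_left _ (Nat.div_mul_le_self _ _)).trans (le_of_eq ?_)
  rw [← pow_succ', Nat.sub_add_cancel hk]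

lemma AlmostNondefective.succ [Infinite K] {n k : ℕ} (hk : 1 ≤ k) (hn : 1 ≤ n)
    (h : AlmostNondefective K n k) (hb : k * (n * (k + 1) + 1) < (n + 1) ^ (k - 1)) :
    AlmostNondefective K n (k + 1) := by
  refine .of_nondefective h.1 (mul_pow_div_mul_le hk) ?_
  obtain ⟨j, rfl⟩ := Nat.exists_eq_add_of_le' hk
  rw [Nat.add_sub_cancel] at hb ⊢
  by_contra! hlt
  set t := (n + 1) ^ j / (n * (j + 1) + 1) with ht
  have h1 : (n + 1) ^ j ≤ t * (n * (j + 1) + 1) + n * (j + 1) := by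
    have := Nat.lt_mul_div_succ ((n + 1) ^ j) (show 0 < n * (j + 1) + 1 by omega)
    rw [← ht] at this
    linarith
  have h2 : (n + 1) * t * (n * (j + 1 + 1) + 1) ≤ (n + 1) ^ (j + 1) :=
    (Nat.mul_le_mul_right _ hlt).trans (Nat.div_mul_le_self _ _)
  rw [pow_succ', mul_assoc] at h2
  have h3 := Nat.le_of_mul_le_mul_left h2 (Nat.succ_pos n)
  generalize (n + 1) ^ j = A at *
  have h4 : A * (n * (j + 1 + 1) + 1) ≤
      A * (n * (j + 1) + 1) + n * (j + 1) * (n * (j + 1 + 1) + 1) := by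
    calc A * (n * (j + 1 + 1) + 1)
        ≤ (t * (n * (j + 1) + 1) + n * (j + 1)) * (n * (j + 1 + 1) + 1) :=
          Nat.mul_le_mul_right _ h1
      _ = (t * (n * (j + 1 + 1) + 1)) * (n * (j + 1) + 1)
          + n * (j + 1) * (n * (j + 1 + 1) + 1) := by ring
      _ ≤ _ := Nat.add_le_add_right (Nat.mul_le_mul_right _ h3) _
  have h5 : n * A ≤ n * ((j + 1) * (n * (j + 1 + 1) + 1)) := by linarith
  exact absurd (Nat.le_of_mul_le_mul_left h5 hn) (not_le.2 hb)

lemma bound_succ {n k : ℕ} (hk : 2 ≤ k) (hn : 1 ≤ n)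
    (hb : k * (n * (k + 1) + 1) < (n + 1) ^ (k - 1)) :
    (k + 1) * (n * (k + 1 + 1) + 1) < (n + 1) ^ k := by
  obtain ⟨j, rfl⟩ := Nat.exists_eq_add_of_le' hk
  have e : (n + 1) ^ (j + 2) = (n + 1) * (n + 1) ^ (j + 2 - 1) := by rw [← pow_succ']; rfl
  rw [e]
  generalize (n + 1) ^ (j + 2 - 1) = A at *
  have : 2 * A ≤ (n + 1) * A := Nat.mul_le_mul_right _ (by omega)
  nlinarith [Nat.zero_le (n * (j * j)), Nat.zero_le (n * j)]

lemma AlmostNondefective.of_bound [Infinite K] {n k₀ : ℕ} (hk₀ : 2 ≤ k₀) (hn : 1 ≤ n)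
    (h : AlmostNondefective K n k₀) (hb : k₀ * (n * (k₀ + 1) + 1) < (n + 1) ^ (k₀ - 1))
    {k : ℕ} (hk : k₀ ≤ k) : AlmostNondefective K n k := by
  suffices AlmostNondefective K n k ∧ k * (n * (k + 1) + 1) < (n + 1) ^ (k - 1) from this.1
  induction k, hk using Nat.le_induction with
  | base => exact ⟨h, hb⟩
  | succ k hk ih =>
    exact ⟨ih.1.succ (by omega) hn ih.2, bound_succ (by omega) hn ih.2⟩

lemma almostNondefective_one [Infinite K] (h : Nondefective K 1 3 2) {k : ℕ} (hk : 3 ≤ k) :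
    AlmostNondefective K 1 k := by
  have h31 : Nondefective K 1 3 1 := h.mono (by norm_num) (by norm_num)
  have h42 : Nondefective K 1 4 2 := h31.step
  have c43 : CorankLE K (Fin 2 → K) 4 3 2 :=
    CorankLE.step ![2, 1] ![0, 4] (by simp) (by
      intro c
      fin_cases c
      exacts [h, h31])
  have h54 : Nondefective K 1 5 4 := h42.step
  have c55 : CorankLE K (Fin 2 → K) 5 5 3 :=
    CorankLE.step ![3, 2] ![2, 6] (by simp) (by
      intro c
      fin_cases c
      exacts [c43, h42])
  have h68 : Nondefective K 1 6 8 := h54.step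
  have h7 : AlmostNondefective K 1 7 := .of_eq h68 (by norm_num)
  rcases le_or_gt 7 k with h7k | h7k
  · exact .of_bound (by norm_num) le_rfl h7 (by norm_num) h7k
  · interval_cases k
    · exact ⟨h, (h.corankLE_zero (by norm_num)).mono (by norm_num) le_rfl⟩
    · exact .of_nondefective h (by norm_num) (by norm_num)
    · exact ⟨h54, c43.step_uniform⟩
    · exact ⟨h68, c55.step_uniform⟩

end Step

section BilinearPieces

variable {K : Type*} [Field K]

lemma PieceCorankLE.of_bilinear {I X Y : Type*} [Fintype I] [DecidableEq I] [Fintype X]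
    [Fintype Y] {d N x y : ℕ} (hI : Fintype.card I = N) (hX : Fintype.card X = x)
    (hY : Fintype.card Y = y) (γ : X → Fin d → K) (a : X → I → K) (r₁ r₂ : Y → I → K)
    (h : ∀ B : Fin d → ((I → K) →ₗ[K] (I → K) →ₗ[K] K), (∀ x c, B c (a x) (a x) = 0) →
      (∀ x w, ∑ c, γ x c * B c w (a x) = 0) → (∀ x w, ∑ c, γ x c * B c (a x) w = 0) →
      (∀ y c, B c (r₁ y) (r₂ y) = 0) → ∀ c i j, B c (Pi.single i 1) (Pi.single j 1) = 0) :
    PieceCorankLE K (Fin N → K) d 2 x y 0 := by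
  let φ : (I → K) ≃ₗ[K] (Fin N → K) :=
    LinearEquiv.funCongrLeft K K (Fintype.equivFinOfCardEq hI).symm
  refine (pieceCorankLE_iff hX hY).2 ⟨γ, fun x => ![φ (a x), φ (a x)],
    fun y => ![φ (r₁ y), φ (r₂ y)], ?_⟩
  rw [Nat.le_zero, Submodule.finrank_eq_zero, Submodule.eq_bot_iff]
  intro g hg
  have hup0 : ∀ u v w : Fin N → K, Function.update ![u, v] 0 w = ![w, v] := by
    intro u v w
    ext j
    fin_cases j <;> simp
  have hup1 : ∀ u v w : Fin N → K, Function.update ![u, v] 1 w = ![u, w] := by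
    intro u v w
    ext j
    fin_cases j <;> simp
  have hadd0 : ∀ c (u v w : Fin N → K), g c ![u + v, w] = g c ![u, w] + g c ![v, w] := by
    intro c u v w
    simpa [hup0] using (g c).map_update_add ![0, w] 0 u v
  have hadd1 : ∀ c (u v w : Fin N → K), g c ![w, u + v] = g c ![w, u] + g c ![w, v] := by
    intro c u v w
    simpa [hup1] using (g c).map_update_add ![w, 0] 1 u v
  have hsmul0 : ∀ c (t : K) (u w : Fin N → K), g c ![t • u, w] = t * g c ![u, w] := by
    intro c t u w
    simpa [hup0] using (g c).map_update_smul ![0, w] 0 t u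
  have hsmul1 : ∀ c (t : K) (u w : Fin N → K), g c ![w, t • u] = t * g c ![w, u] := by
    intro c t u w
    simpa [hup1] using (g c).map_update_smul ![w, 0] 1 t u
  let B : Fin d → ((I → K) →ₗ[K] (I → K) →ₗ[K] K) := fun c =>
    LinearMap.mk₂ K (fun u v => g c ![φ u, φ v]) (by simp [hadd0]) (by simp [hsmul0])
      (by simp [hadd1]) (by simp [hsmul1])
  have hB := h B (fun x c => hg.1 x c)
    (fun x w => by simpa [B, hup0] using hg.2.2 x 0 (φ w))
    (fun x w => by simpa [B, hup1] using hg.2.2 x 1 (φ w)) (fun y c => hg.2.1 y c)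
  ext1 c
  have hBc : B c = 0 := (Pi.basisFun K I).ext fun i => (Pi.basisFun K I).ext fun j => by
    simpa using hB c i j
  refine MultilinearMap.ext fun m => ?_
  have hm : m = ![φ (φ.symm (m 0)), φ (φ.symm (m 1))] := by
    ext j
    fin_cases j <;> simp
  rw [hm]
  exact congrArg (fun b : (I → K) →ₗ[K] (I → K) →ₗ[K] K => b (φ.symm (m 0)) (φ.symm (m 1))) hBc

/-- Pieces with a single slice. -/
lemma pieceCorankLE_one (x z : ℕ) :
    PieceCorankLE K (Fin (x + z) → K) 1 2 x (z * z) 0 := by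
  refine .of_bilinear (I := Fin x ⊕ Fin z) (X := Fin x) (Y := Fin z × Fin z) (by simp) (by simp)
    (by simp) (fun _ _ => 1) (fun i => Pi.single (.inl i) 1) (fun y => Pi.single (.inr y.1) 1)
    (fun y => Pi.single (.inr y.2) 1) fun B _ h2 h3 h4 c i j => ?_
  obtain rfl := Subsingleton.elim c 0
  rcases i with i | i
  · simpa using h3 i (Pi.single j 1)
  · rcases j with j | j
    · simpa using h2 j (Pi.single (.inr i) 1)
    · exact h4 (i, j) 0

/-- Pieces with two slices. -/
lemma pieceCorankLE_two [CharZero K] (x z : ℕ) :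
    PieceCorankLE K (Fin (x + 2 + z) → K) 2 2 (x + 2) (z * (x + 2 + z)) 0 := by
  refine .of_bilinear (I := Fin (x + 2) ⊕ Fin z) (X := Fin (x + 2))
    (Y := Fin z × (Fin (x + 2) ⊕ Fin z)) (by simp) (by simp) (by simp)
    (fun i => ![1, ((i : ℕ) : K)]) (fun i => Pi.single (.inl i) 1)
    (fun y => Sum.elim (fun j => Pi.single (.inr y.1) 1 + Pi.single (.inl (j + 1)) 1)
      (fun _ => Pi.single (.inr y.1) 1) y.2)
    (fun y => Sum.elim (fun j => Pi.single (.inl j) 1 + Pi.single (.inr y.1) 1)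
      (fun j => Pi.single (.inr j) 1) y.2) fun B h1 h2 h3 h4 => ?_
  simp only [Fin.sum_univ_two, Matrix.cons_val_zero, Matrix.cons_val_one, one_mul] at h2 h3
  have hτ : ∀ i j : Fin (x + 2), i ≠ j → ((i : ℕ) : K) - ((j : ℕ) : K) ≠ 0 := by
    intro i j hij
    rw [sub_ne_zero, Ne, Nat.cast_inj]
    exact fun h => hij (Fin.ext h)
  have hlin : ∀ (i j : Fin (x + 2)) (u v : K), i ≠ j → u + (i : ℕ) * v = 0 →
      u + (j : ℕ) * v = 0 → u = 0 ∧ v = 0 := by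
    intro i j u v hij hi hj
    have hv : v = 0 := by
      refine (mul_eq_zero.1
        (?_ : (((i : ℕ) : K) - ((j : ℕ) : K)) * v = 0)).resolve_left (hτ i j hij)
      linear_combination hi - hj
    subst hv
    exact ⟨by simpa using hi, rfl⟩
  have hll : ∀ c i j, B c (Pi.single (.inl i) 1) (Pi.single (.inl j) 1) = 0 := by
    intro c i j
    by_cases hij : i = j
    · subst hij
      exact h1 i c
    · have := hlin i j _ _ hij (h3 i (Pi.single (.inl j) 1)) (h2 j (Pi.single (.inl i) 1))
      fin_cases c
      exacts [this.1, this.2]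
  have hrr : ∀ c i j, B c (Pi.single (.inr i) 1) (Pi.single (.inr j) 1) = 0 :=
    fun c i j => h4 (i, .inr j) c
  have hmix : ∀ c i j, B c (Pi.single (.inl (j + 1)) 1) (Pi.single (.inr i) 1) = 0 ∧
      B c (Pi.single (.inr i) 1) (Pi.single (.inl j) 1) = 0 := by
    intro c i j
    have hs : ∀ c, B c (Pi.single (.inr i) 1) (Pi.single (.inl j) 1) +
        B c (Pi.single (.inl (j + 1)) 1) (Pi.single (.inr i) 1) = 0 := fun c => by
      have := h4 (i, .inl j) c
      simpa [hll, hrr] using this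
    have e1 := h2 j (Pi.single (.inr i) 1)
    have e2 := h3 (j + 1) (Pi.single (.inr i) 1)
    have hne : j + 1 ≠ j := by simp
    have := hlin (j + 1) j _ _ hne e2 (by linear_combination (hs 0) + (j : ℕ) * (hs 1) - e1)
    have h5 : B c (Pi.single (.inl (j + 1)) 1) (Pi.single (.inr i) 1) = 0 := by
      fin_cases c
      exacts [this.1, this.2]
    refine ⟨h5, ?_⟩
    simpa [h5] using hs c
  rintro c (i | i) (j | j)
  · exact hll c i j
  · simpa using (hmix c j (i - 1)).1
  · exact (hmix c i j).2
  · exact hrr c i j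

end BilinearPieces

section QuadraticPieces

variable {K : Type*} [Field K]

lemma quadratic_eq_zero {t₁ t₂ t₃ a b c : K} (h12 : t₁ ≠ t₂) (h13 : t₁ ≠ t₃) (h23 : t₂ ≠ t₃)
    (h1 : a + t₁ * b + t₁ ^ 2 * c = 0) (h2 : a + t₂ * b + t₂ ^ 2 * c = 0)
    (h3 : a + t₃ * b + t₃ ^ 2 * c = 0) : a = 0 ∧ b = 0 ∧ c = 0 := by
  have e12 : b + (t₁ + t₂) * c = 0 := by
    refine (mul_eq_zero.1 (?_ : (t₁ - t₂) * (b + (t₁ + t₂) * c) = 0)).resolve_left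
      (sub_ne_zero.2 h12)
    linear_combination h1 - h2
  have e13 : b + (t₁ + t₃) * c = 0 := by
    refine (mul_eq_zero.1 (?_ : (t₁ - t₃) * (b + (t₁ + t₃) * c) = 0)).resolve_left
      (sub_ne_zero.2 h13)
    linear_combination h1 - h3
  have hc : c = 0 := by
    refine (mul_eq_zero.1 (?_ : (t₂ - t₃) * c = 0)).resolve_left (sub_ne_zero.2 h23)
    linear_combination e12 - e13
  subst hc
  have hb : b = 0 := by simpa using e12
  subst hb
  exact ⟨by simpa using h1, rfl, rfl⟩

/-- The three nonzero terms of the value at `(e x + e z) ⊗ (e z + e y)` of a quadratic family of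
bilinear forms all vanish with their sum if they vanish at the expected parameters. -/
lemma quadratic_triangle {t₁ t₂ t₃ : K} {f g h : Fin 3 → K} (h12 : t₁ ≠ t₂) (h13 : t₁ ≠ t₃)
    (h23 : t₂ ≠ t₃) (hs : ∀ c, f c + g c + h c = 0)
    (f1 : f 0 + t₁ * f 1 + t₁ ^ 2 * f 2 = 0) (f2 : f 0 + t₂ * f 1 + t₂ ^ 2 * f 2 = 0)
    (g1 : g 0 + t₁ * g 1 + t₁ ^ 2 * g 2 = 0) (g3 : g 0 + t₃ * g 1 + t₃ ^ 2 * g 2 = 0)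
    (h2 : h 0 + t₂ * h 1 + t₂ ^ 2 * h 2 = 0) (h3 : h 0 + t₃ * h 1 + t₃ ^ 2 * h 2 = 0) :
    (∀ c, f c = 0) ∧ (∀ c, g c = 0) ∧ ∀ c, h c = 0 := by
  have hf := quadratic_eq_zero h12 h13 h23 f1 f2
    (by linear_combination (hs 0) + t₃ * (hs 1) + t₃ ^ 2 * (hs 2) - g3 - h3)
  have hg := quadratic_eq_zero h12 h13 h23 g1
    (by linear_combination (hs 0) + t₂ * (hs 1) + t₂ ^ 2 * (hs 2) - f2 - h2) g3
  have hf' : ∀ c, f c = 0 := by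
    intro c
    fin_cases c
    exacts [hf.1, hf.2.1, hf.2.2]
  have hg' : ∀ c, g c = 0 := by
    intro c
    fin_cases c
    exacts [hg.1, hg.2.1, hg.2.2]
  exact ⟨hf', hg', fun c => by simpa [hf', hg'] using hs c⟩

variable {I Y : Type*} [DecidableEq I]

/-- The conclusions drawn from tangent vectors at the points `e i ⊗ e i` with parameters `τ i`,
and points attached to transitive triangles. -/
lemma bilinear_triangles {τ : I → K} (hτ : Function.Injective τ) {T : Y → I × I × I}
    (hT : ∀ y, (T y).1 ≠ (T y).2.1 ∧ (T y).1 ≠ (T y).2.2 ∧ (T y).2.1 ≠ (T y).2.2)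
    {B : Fin 3 → ((I → K) →ₗ[K] (I → K) →ₗ[K] K)}
    (h1 : ∀ i c, B c (Pi.single i 1) (Pi.single i 1) = 0)
    (h2 : ∀ i w, ∑ c, ![1, τ i, τ i ^ 2] c * B c w (Pi.single i 1) = 0)
    (h3 : ∀ i w, ∑ c, ![1, τ i, τ i ^ 2] c * B c (Pi.single i 1) w = 0)
    (h4 : ∀ y c, B c (Pi.single (T y).1 1 + Pi.single (T y).2.1 1)
      (Pi.single (T y).2.1 1 + Pi.single (T y).2.2 1) = 0) (y : Y) :
    (∀ c, B c (Pi.single (T y).1 1) (Pi.single (T y).2.1 1) = 0) ∧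
    (∀ c, B c (Pi.single (T y).1 1) (Pi.single (T y).2.2 1) = 0) ∧
    (∀ c, B c (Pi.single (T y).2.1 1) (Pi.single (T y).2.2 1) = 0) := by
  simp only [Fin.sum_univ_three, Matrix.cons_val_zero, Matrix.cons_val_one, Matrix.cons_val,
    one_mul] at h2 h3
  obtain ⟨h12, h13, h23⟩ := hT y
  refine quadratic_triangle (hτ.ne h12) (hτ.ne h13) (hτ.ne h23) (fun c => ?_) (h3 _ _) (h2 _ _)
    (h3 _ _) (h2 _ _) (h3 _ _) (h2 _ _)
  have := h4 y c
  simp only [map_add, LinearMap.add_apply, h1] at this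
  linear_combination this

lemma PieceCorankLE.of_triangles [Fintype I] [Fintype Y] [Infinite K] {N y : ℕ}
    (hI : Fintype.card I = N)
    (hY : Fintype.card Y = y) (T : Y → I × I × I)
    (hT : ∀ y, (T y).1 ≠ (T y).2.1 ∧ (T y).1 ≠ (T y).2.2 ∧ (T y).2.1 ≠ (T y).2.2)
    (hZ : ∀ Z : I → I → Prop, (∀ y, Z (T y).1 (T y).2.1 ∧ Z (T y).1 (T y).2.2 ∧
      Z (T y).2.1 (T y).2.2) → (∀ i, Z i i) → ∀ i j, Z i j) :
    PieceCorankLE K (Fin N → K) 3 2 N y 0 := by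
  let τ : I ↪ K := (Fintype.equivFin I).toEmbedding.trans
    (Fin.valEmbedding.trans (Infinite.natEmbedding K))
  refine .of_bilinear (I := I) (X := I) (Y := Y) hI hI hY (fun i => ![1, τ i, τ i ^ 2])
    (fun i => Pi.single i 1) (fun y => Pi.single (T y).1 1 + Pi.single (T y).2.1 1)
    (fun y => Pi.single (T y).2.1 1 + Pi.single (T y).2.2 1) fun B h1 h2 h3 h4 c i j => ?_
  exact hZ (fun i j => ∀ c, B c (Pi.single i 1) (Pi.single j 1) = 0)
    (bilinear_triangles τ.injective hT h1 h2 h3 h4) h1 i j c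

lemma PieceCorankLE.of_triangles_add_one [Fintype I] [Fintype Y] [Infinite K] {N y : ℕ}
    (hI : Fintype.card I = N)
    (hY : Fintype.card Y = y) (T : Y → I × I × I)
    (hT : ∀ y, (T y).1 ≠ (T y).2.1 ∧ (T y).1 ≠ (T y).2.2 ∧ (T y).2.1 ≠ (T y).2.2)
    (hZ : ∀ Z : I → I → Prop, (∀ y, Z (T y).1 (T y).2.1 ∧ Z (T y).1 (T y).2.2 ∧
      Z (T y).2.1 (T y).2.2) → (∀ i, Z i i) →
      (∀ i j₀, i ≠ j₀ → (∀ j, j ≠ j₀ → Z i j) → Z i j₀) →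
      (∀ i₀ j, i₀ ≠ j → (∀ i, i ≠ i₀ → Z i j) → Z i₀ j) → ∀ i j, Z i j) :
    PieceCorankLE K (Fin N → K) 3 2 (N + 1) y 0 := by
  let τ : Option I ↪ K := (Fintype.equivFin (Option I)).toEmbedding.trans
    (Fin.valEmbedding.trans (Infinite.natEmbedding K))
  refine .of_bilinear (I := I) (X := Option I) (Y := Y) hI (by simp [hI]) hY
    (fun i => ![1, τ i, τ i ^ 2]) (fun i => i.elim (∑ i, Pi.single i 1) fun i => Pi.single i 1)
    (fun y => Pi.single (T y).1 1 + Pi.single (T y).2.1 1)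
    (fun y => Pi.single (T y).2.1 1 + Pi.single (T y).2.2 1) fun B h1 h2 h3 h4 c i j => ?_
  have h5 := bilinear_triangles (τ := fun i => τ (some i))
    (fun i j hij => Option.some_injective _ (τ.injective hij)) hT (fun i => h1 (some i))
    (fun i => h2 (some i)) (fun i => h3 (some i)) h4
  simp only [Fin.sum_univ_three, Matrix.cons_val_zero, Matrix.cons_val_one, Matrix.cons_val,
    one_mul] at h2 h3
  have key : ∀ i j, i ≠ j → B 0 (Pi.single i 1) (Pi.single j 1)
      + τ none * B 1 (Pi.single i 1) (Pi.single j 1)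
      + τ none ^ 2 * B 2 (Pi.single i 1) (Pi.single j 1) = 0 →
      ∀ c, B c (Pi.single i 1) (Pi.single j 1) = 0 := by
    intro i j hij h0 c
    have := quadratic_eq_zero (t₁ := τ (some i)) (t₂ := τ (some j)) (t₃ := τ none)
      (by simpa using hij) (by simp) (by simp) (h3 (some i) _) (h2 (some j) _) h0
    fin_cases c
    exacts [this.1, this.2.1, this.2.2]
  refine hZ (fun i j => ∀ c, B c (Pi.single i 1) (Pi.single j 1) = 0) h5
    (fun i => h1 (some i)) (fun i j₀ hij hj => key i j₀ hij ?_)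
    (fun i₀ j hij hi => key i₀ j hij ?_) i j c
  · have hsum : ∀ c, B c (Pi.single i 1) (∑ j, Pi.single j 1)
        = B c (Pi.single i 1) (Pi.single j₀ 1) := fun c => by
      rw [map_sum]
      exact Finset.sum_eq_single j₀ (fun j _ hne => hj j hne c) (by simp)
    simpa [hsum] using h2 none (Pi.single i 1)
  · have hsum : ∀ c, B c (∑ j, Pi.single j 1) (Pi.single j 1)
        = B c (Pi.single i₀ 1) (Pi.single j 1) := fun c => by
      rw [map_sum, LinearMap.sum_apply]
      exact Finset.sum_eq_single i₀ (fun i _ hne => hi i hne c) (by simp)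
    have h6 := h3 none (Pi.single j 1)
    simp only [Option.elim_none, hsum] at h6
    exact h6

end QuadraticPieces

section Bose

lemma zmod_half_add_half (r : ℕ) (v : ZMod (2 * r + 1)) :
    v * ((r : ZMod (2 * r + 1)) + 1) + v * ((r : ZMod (2 * r + 1)) + 1) = v := by
  have h : ((2 * r + 1 : ℕ) : ZMod (2 * r + 1)) = 0 := ZMod.natCast_self _
  push_cast at h
  linear_combination v * h

lemma zmod_add_self_ne_zero {r : ℕ} {d : ZMod (2 * r + 1)} (hd : d ≠ 0) : d + d ≠ 0 := by
  intro h
  have := zmod_half_add_half r d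
  rw [← add_mul, h, zero_mul] at this
  exact hd this.symm

/-- Every arc between two different columns lies in a triangle of the Bose construction. -/
lemma bose_arcs {r : ℕ} {Z : ZMod (2 * r + 1) × Fin 3 → ZMod (2 * r + 1) × Fin 3 → Prop}
    (h : ∀ i x d, d ≠ 0 → Z (x, i) (x + d, i + 1) ∧ Z (x, i) (x + (d + d), i) ∧
      Z (x + d, i + 1) (x + (d + d), i)) (u v : ZMod (2 * r + 1)) (i j : Fin 3) (huv : u ≠ v) :
    Z (u, i) (v, j) := by
  have hsub : v - u ≠ 0 := sub_ne_zero.2 huv.symm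
  obtain rfl | rfl | rfl : j = i ∨ j = i + 1 ∨ i = j + 1 := by
    revert i j
    decide
  · have hd : (v - u) * ((r : ZMod (2 * r + 1)) + 1) ≠ 0 := by
      intro h0
      have := zmod_half_add_half r (v - u)
      rw [h0, add_zero] at this
      exact hsub this.symm
    have := (h j u _ hd).2.1
    rwa [zmod_half_add_half, add_sub_cancel] at this
  · have := (h i u _ hsub).1
    rwa [add_sub_cancel] at this
  · have := (h j (u - (v - u)) _ hsub).2.2
    rwa [sub_add_cancel, ← add_assoc, sub_add_cancel, add_sub_cancel] at this

variable {K : Type*} [Field K] [Infinite K]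

/-- Pieces with three slices, for odd multiples of three. -/
lemma pieceCorankLE_three_of_three_mul (r : ℕ) :
    PieceCorankLE K (Fin (3 * (2 * r + 1)) → K) 3 2 (3 * (2 * r + 1))
      (3 * ((2 * r + 1) * (2 * r)) + (2 * r + 1) * 2) 0 := by
  refine .of_triangles (I := ZMod (2 * r + 1) × Fin 3)
    (Y := (Fin 3 × ZMod (2 * r + 1) × {d : ZMod (2 * r + 1) // d ≠ 0}) ⊕ ZMod (2 * r + 1) × Fin 2)
    (by simp [ZMod.card, mul_comm]) (by simp [ZMod.card, -ne_eq])
    (Sum.elim (fun y => ((y.2.1, y.1), (y.2.1 + y.2.2.1, y.1 + 1),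
      (y.2.1 + (y.2.2.1 + y.2.2.1), y.1)))
      fun y => ![((y.1, 0), (y.1, 1), (y.1, 2)), ((y.1, 2), (y.1, 1), (y.1, 0))] y.2) ?_ ?_
  · rintro (⟨i, x, d, hd⟩ | ⟨x, b⟩)
    · simp [hd, zmod_add_self_ne_zero hd]
    · fin_cases b <;> simp
  · intro Z hT hdiag
    have h1 := bose_arcs (Z := Z) fun i x d hd => hT (.inl (i, x, ⟨d, hd⟩))
    have h2 := fun x => hT (.inr (x, 0))
    have h3 := fun x => hT (.inr (x, 1))
    simp only [Sum.elim_inr, Matrix.cons_val_zero, Matrix.cons_val_one] at h2 h3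
    rintro ⟨x, i⟩ ⟨y, j⟩
    by_cases hxy : x = y
    · subst hxy
      obtain ⟨a, b, c⟩ := h2 x
      obtain ⟨a', b', c'⟩ := h3 x
      fin_cases i <;> fin_cases j <;> first | exact hdiag _ | assumption
    · exact h1 x y i j hxy

/-- Pieces with three slices, for numbers congruent to five modulo six. -/
lemma pieceCorankLE_three_of_three_mul_add_two (r : ℕ) :
    PieceCorankLE K (Fin (3 * (2 * r + 1) + 2) → K) 3 2 (3 * (2 * r + 1) + 2 + 1)
      (3 * ((2 * r + 1) * (2 * r)) + ((2 * r + 1) * 4 + 2 * r)) 0 := by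
  let V : ZMod (2 * r + 1) → Fin 3 → (ZMod (2 * r + 1) × Fin 3) ⊕ Fin 2 := fun x i => .inl (x, i)
  refine .of_triangles_add_one (I := (ZMod (2 * r + 1) × Fin 3) ⊕ Fin 2)
    (Y := (Fin 3 × ZMod (2 * r + 1) × {d : ZMod (2 * r + 1) // d ≠ 0}) ⊕
      (ZMod (2 * r + 1) × Fin 4 ⊕ {d : ZMod (2 * r + 1) // d ≠ 0}))
    (by simp [ZMod.card, mul_comm]) (by simp [ZMod.card, -ne_eq])
    (Sum.elim (fun y => (V y.2.1 y.1, V (y.2.1 + y.2.2.1) (y.1 + 1),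
      V (y.2.1 + (y.2.2.1 + y.2.2.1)) y.1))
      (Sum.elim (fun y => ![(V y.1 0, V y.1 1, .inr 0), (V y.1 0, V y.1 2, .inr 1),
        (V y.1 2, .inr 0, V y.1 0), (.inr 0, V y.1 1, V y.1 2)] y.2)
      fun x => (V x.1 1, .inr 1, V x.1 0))) ?_ ?_
  · rintro (⟨i, x, d, hd⟩ | ⟨x, b⟩ | x)
    · simp [V, hd, zmod_add_self_ne_zero hd]
    · fin_cases b <;> simp [V]
    · simp [V]
  · intro Z hT hdiag hrow hcol
    have hout : ∀ x y i j, x ≠ y → Z (V x i) (V y j) := fun x y i j hxy =>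
      bose_arcs (Z := fun u v => Z (.inl u) (.inl v))
        (fun i x d hd => hT (.inl (i, x, ⟨d, hd⟩))) x y i j hxy
    have h0 := fun x => hT (.inr (.inl (x, 0)))
    have h1 := fun x => hT (.inr (.inl (x, 1)))
    have h2 := fun x => hT (.inr (.inl (x, 2)))
    have h3 := fun x => hT (.inr (.inl (x, 3)))
    have h4 := fun (x : ZMod (2 * r + 1)) (hx : x ≠ 0) => hT (.inr (.inr ⟨x, hx⟩))
    simp only [Sum.elim_inr, Sum.elim_inl, Matrix.cons_val_zero, Matrix.cons_val_one,
      Matrix.cons_val] at h0 h1 h2 h3 h4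
    have key : ∀ (P : (ZMod (2 * r + 1) × Fin 3) ⊕ Fin 2 → Prop) (x : ZMod (2 * r + 1)),
        (∀ y, y ≠ x → ∀ i, P (V y i)) → P (V x 0) → P (V x 1) → P (V x 2) → P (.inr 0) →
        P (.inr 1) → ∀ j, P j := by
      intro P x hy p0 p1 p2 pa pb
      rintro (⟨y, i⟩ | b)
      · by_cases hyx : y = x
        · subst hyx
          fin_cases i
          exacts [p0, p1, p2]
        · exact hy y hyx i
      · fin_cases b
        exacts [pa, pb]
    have v21 : ∀ x, Z (V x 2) (V x 1) := fun x =>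
      hrow _ _ (by simp [V]) (key _ x (fun y hy i _ => hout _ _ _ _ hy.symm) (fun _ => (h2 x).2.1)
        (fun h => absurd rfl h) (fun _ => hdiag _) (fun _ => (h2 x).1) fun _ => (h1 x).2.2)
    have va0 : ∀ x, Z (.inr 0) (V x 0) := fun x => (h2 x).2.2
    have va1 : ∀ x, Z (.inr 0) (V x 1) := fun x => (h3 x).1
    have va2 : ∀ x, Z (.inr 0) (V x 2) := fun x => (h3 x).2.1
    have vaV : ∀ x i, Z (.inr 0) (V x i) := by
      intro x i
      fin_cases i
      exacts [va0 x, va1 x, va2 x]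
    have vVa : ∀ x i, Z (V x i) (.inr 0) := by
      intro x i
      fin_cases i
      exacts [(h0 x).2.1, (h0 x).2.2, (h2 x).1]
    have vab : Z (.inr 0) (.inr 1) :=
      hrow _ _ (by simp) (key _ 0 (fun y _ i _ => vaV y i) (fun _ => va0 0) (fun _ => va1 0)
        (fun _ => va2 0) (fun _ => hdiag _) fun h => absurd rfl h)
    have vb1 : ∀ x, Z (.inr 1) (V x 1) := fun x =>
      hcol _ _ (by simp [V]) (key _ x (fun y hy i _ => hout _ _ _ _ hy) (fun _ => (h0 x).1)
        (fun _ => hdiag _) (fun _ => v21 x) (fun _ => va1 x) fun h => absurd rfl h)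
    have vb2 : ∀ x, Z (.inr 1) (V x 2) := fun x =>
      hcol _ _ (by simp [V]) (key _ x (fun y hy i _ => hout _ _ _ _ hy) (fun _ => (h1 x).1)
        (fun _ => (h3 x).2.2) (fun _ => hdiag _) (fun _ => va2 x) fun h => absurd rfl h)
    have vba : Z (.inr 1) (.inr 0) :=
      hcol _ _ (by simp) (key _ 0 (fun y _ i _ => vVa y i) (fun _ => vVa 0 0) (fun _ => vVa 0 1)
        (fun _ => vVa 0 2) (fun _ => hdiag _) fun h => absurd rfl h)
    have v1b : ∀ x, Z (V x 1) (.inr 1) := by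
      intro x
      by_cases hx : x = 0
      · subst hx
        refine hcol _ _ (by simp [V]) (key _ 0 (fun y hy i _ => ?_) (fun _ => (h1 0).2.1)
          (fun h => absurd rfl h) (fun _ => (h1 0).2.2) (fun _ => vab) fun _ => hdiag _)
        fin_cases i
        exacts [(h1 y).2.1, (h4 y hy).1, (h1 y).2.2]
      · exact (h4 x hx).1
    have v10 : ∀ x, Z (V x 1) (V x 0) := fun x =>
      hrow _ _ (by simp [V]) (key _ x (fun y hy i _ => hout _ _ _ _ hy.symm)
        (fun h => absurd rfl h) (fun _ => hdiag _) (fun _ => (h3 x).2.2) (fun _ => vVa x 1)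
        fun _ => v1b x)
    have vb0 : ∀ x, Z (.inr 1) (V x 0) := by
      intro x
      by_cases hx : x = 0
      · subst hx
        refine hrow _ _ (by simp [V]) (key _ 0 (fun y hy i _ => ?_) (fun h => absurd rfl h)
          (fun _ => vb1 0) (fun _ => vb2 0) (fun _ => vba) fun _ => hdiag _)
        fin_cases i
        exacts [(h4 y hy).2.2, vb1 y, vb2 y]
      · exact (h4 x hx).2.2
    rintro (⟨x, i⟩ | a)
    · refine key _ x (fun y hy j => hout _ _ _ _ hy.symm) ?_ ?_ ?_ (vVa x i) ?_
      · fin_cases i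
        exacts [hdiag _, v10 x, (h2 x).2.1]
      · fin_cases i
        exacts [(h0 x).1, hdiag _, v21 x]
      · fin_cases i
        exacts [(h1 x).1, (h3 x).2.2, hdiag _]
      · fin_cases i
        exacts [(h1 x).2.1, v1b x, (h1 x).2.2]
    · fin_cases a
      · exact key _ 0 (fun y _ i => vaV y i) (vaV 0 0) (vaV 0 1) (vaV 0 2) (hdiag _) vab
      · refine key _ 0 (fun y _ i => ?_) (vb0 0) (vb1 0) (vb2 0) vba (hdiag _)
        fin_cases i
        exacts [vb0 y, vb1 y, vb2 y]

end Bose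

section ThreeFactors

variable {K : Type*} [Field K]

lemma pieceCorankLE_zero {V : Type*} [AddCommGroup V] [Module K V] (k y : ℕ) :
    PieceCorankLE K V 0 k 0 y 0 :=
  ⟨fun _ => Fin.elim0, Fin.elim0, fun _ => 0, by
    rw [Nat.le_zero]
    exact Module.finrank_zero_of_subsingleton⟩

variable [CharZero K]

/-- Split the first of three factors into `h` pieces of dimension two and a last piece. -/
lemma corankLE_three {N h d x y e : ℕ} (hN : 2 * h + d = N) (hx : 2 ≤ x) (hxN : x ≤ N)
    (hl : PieceCorankLE K (Fin N → K) d 2 y (h * x) e) :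
    CorankLE K (Fin N → K) 3 (h * x + y)
      (h * (2 * ((N - x) * N - (h * x + y - x))) + e) := by
  have hp : PieceCorankLE K (Fin N → K) 2 2 x (h * x + y - x)
      (2 * ((N - x) * N - (h * x + y - x))) := by
    refine PieceCorankLE.change ?_ _
    obtain ⟨a, rfl⟩ := Nat.exists_eq_add_of_le' hx
    obtain ⟨z, rfl⟩ := Nat.exists_eq_add_of_le hxN
    rw [Nat.add_sub_cancel_left]
    exact pieceCorankLE_two a z
  have := CorankLE.split (K := K) (N := N) (k := 2) (s := h * x + y)
    (fun l : Option (Fin h) => l.elim d fun _ => 2) (fun l => l.elim y fun _ => x)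
    (fun l => l.elim e fun _ => 2 * ((N - x) * N - (h * x + y - x)))
    (by rw [Fintype.sum_option]; simp; omega) (by rw [Fintype.sum_option]; simp; omega) (by
      rintro (_ | l)
      · simpa using hl
      · exact hp)
  refine this.mono le_rfl (le_of_eq ?_)
  rw [Fintype.sum_option]
  simp [add_comm]

lemma corankLE_three_even {N h x : ℕ} (hN : 2 * h = N) (hx : 2 ≤ x) (hxN : x ≤ N) :
    CorankLE K (Fin N → K) 3 (h * x) (h * (2 * ((N - x) * N - (h * x - x)))) :=
  corankLE_three (d := 0) (y := 0) (e := 0) hN hx hxN (pieceCorankLE_zero _ _)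

lemma corankLE_three_odd {N h x y : ℕ} (hN : 2 * h + 1 = N) (hx : 2 ≤ x) (hxN : x ≤ N)
    (hy : y ≤ N) :
    CorankLE K (Fin N → K) 3 (h * x + y)
      (h * (2 * ((N - x) * N - (h * x + y - x))) + ((N - y) * (N - y) - h * x)) := by
  refine corankLE_three hN hx hxN ?_
  obtain ⟨z, rfl⟩ := Nat.exists_eq_add_of_le hy
  rw [Nat.add_sub_cancel_left]
  have := (pieceCorankLE_one (K := K) y z).change (h * x)
  rwa [one_mul] at this

lemma nondefective_three_of_even {n h x : ℕ} (hn : n + 1 = 2 * h) (hx : 2 ≤ x) (hxn : x ≤ n + 1)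
    (hb : h * x + x * n ≤ (n + 1) ^ 2) : Nondefective K n 3 (h * x) := by
  refine (corankLE_three_even hn.symm hx hxn).mono le_rfl (le_of_eq ?_)
  have h1 : x ≤ h * x := Nat.le_mul_of_pos_left _ (by omega)
  have h2 : h * x - x ≤ (n + 1 - x) * (n + 1) := by
    zify [h1, hxn] at hb ⊢
    linarith
  have h3 : h * x * (n * 3 + 1) ≤ (n + 1) ^ 3 := by
    have := Nat.mul_le_mul_left (n + 1) hb
    zify at this hn ⊢
    nlinarith
  zify [h1, h2, h3, hxn]
  zify at hn
  rw [show (n : ℤ) = 2 * h - 1 by linarith]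
  ring

lemma three_mul_mul_le {n h x : ℕ} (hn : n = 2 * h) (hb : h * x + x * n ≤ (n + 1) ^ 2) :
    h * x * (n * 3 + 1) ≤ (n + 1) ^ 3 := by
  have := Nat.mul_le_mul_left (n + 1) hb
  subst hn
  nlinarith [Nat.zero_le (h * x)]

lemma nondefective_three_of_odd {n h x : ℕ} (hn : n = 2 * h) (hx : 2 ≤ x) (hxn : x ≤ n + 1)
    (hh : 1 ≤ h) (hb : h * x + x * n ≤ (n + 1) ^ 2) : Nondefective K n 3 (h * x) := by
  refine (corankLE_three_odd (y := 0) (N := n + 1) (by omega) hx hxn (Nat.zero_le _)).mono le_rfl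
    (le_of_eq ?_)
  have h3 := three_mul_mul_le hn hb
  have h1 : x ≤ h * x := Nat.le_mul_of_pos_left _ hh
  have h2 : h * x - x ≤ (n + 1 - x) * (n + 1) := by
    zify [h1, hxn] at hb ⊢
    linarith
  have h4 : h * x ≤ (n + 1) * (n + 1) := by
    rw [← pow_two]
    omega
  simp only [add_zero, Nat.sub_zero]
  zify [h1, h2, h3, h4, hxn]
  subst hn
  push_cast
  ring

lemma corankLE_three_zero_of_even {n h x : ℕ} (hn : n + 1 = 2 * h) (hx : 2 ≤ x) (hxn : x ≤ n + 1)
    (hb : (n + 1) ^ 2 ≤ h * x + x * n) : CorankLE K (Fin (n + 1) → K) 3 (h * x) 0 := by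
  refine (corankLE_three_even hn.symm hx hxn).mono le_rfl (le_of_eq ?_)
  have h1 : x ≤ h * x := Nat.le_mul_of_pos_left _ (by omega)
  have h2 : (n + 1 - x) * (n + 1) ≤ h * x - x := by
    zify [h1, hxn] at hb ⊢
    linarith
  rw [Nat.sub_eq_zero_of_le h2, mul_zero, mul_zero]

lemma sub_mul_sub_eq_zero {n s x : ℕ} (hxn : x ≤ n + 1) (hxs : x ≤ s)
    (hb : (n + 1) ^ 2 ≤ s + x * n) : (n + 1 - x) * (n + 1) - (s - x) = 0 := by
  rw [Nat.sub_eq_zero_iff_le]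
  zify [hxs, hxn] at hb ⊢
  linarith

lemma corankLE_three_zero_of_odd {n h x y : ℕ} (hn : n = 2 * h) (hx : 2 ≤ x) (hxn : x ≤ n + 1)
    (hy : y ≤ n + 1) (hh : 1 ≤ h) (hb : (n + 1) ^ 2 ≤ h * x + y + x * n)
    (hb' : (n + 1 - y) * (n + 1 - y) ≤ h * x) :
    CorankLE K (Fin (n + 1) → K) 3 (h * x + y) 0 := by
  refine (corankLE_three_odd (N := n + 1) (by omega) hx hxn hy).mono le_rfl (le_of_eq ?_)
  have h1 : x ≤ h * x := Nat.le_mul_of_pos_left _ hh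
  rw [Nat.sub_eq_zero_of_le hb', sub_mul_sub_eq_zero hxn (by omega) hb]
  simp

variable (K) in
lemma almostNondefective_three_of_even {n h : ℕ} (hn : n + 1 = 2 * h) :
    AlmostNondefective K n 3 := by
  obtain rfl | hh : h = 1 ∨ 2 ≤ h := by omega
  · obtain rfl : n = 1 := by omega
    have : Nondefective K 1 3 2 :=
      nondefective_three_of_even (h := 1) hn le_rfl le_rfl (by norm_num)
    exact ⟨this, (this.corankLE_zero (by norm_num)).mono (by norm_num) le_rfl⟩
  have h1 := Nat.div_mul_le_self ((n + 1) ^ 2) (n * 3 + 1)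
  have h2 := Nat.lt_mul_div_succ ((n + 1) ^ 2) (show 0 < n * 3 + 1 by omega)
  rw [AlmostNondefective, show 3 - 1 = 2 from rfl]
  generalize (n + 1) ^ 2 / (n * 3 + 1) = m at *
  have hm1 : 1 ≤ m := by
    by_contra! hm
    obtain rfl : m = 0 := by omega
    nlinarith
  have hm2 : m + 1 ≤ h := by
    by_contra! hm
    nlinarith
  constructor
  · rw [hn, show 2 * h * m = h * (2 * m) by ring]
    refine nondefective_three_of_even hn (by omega) (by omega) ?_
    zify at *
    nlinarith
  · rw [show (n + 1) * (m + 1) = h * (2 * (m + 1)) by rw [hn]; ring]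
    refine corankLE_three_zero_of_even hn (by omega) (by omega) ?_
    zify at *
    nlinarith

lemma div_eq_of_mod_three {m r : ℕ} (hm : 1 ≤ m) (hr : r < 3) {n : ℕ} (hn : n + 1 = 3 * m + r) :
    (n + 1) ^ 2 / (n * 3 + 1) = m := by
  obtain ⟨a, rfl⟩ := Nat.exists_eq_add_of_le' hm
  obtain rfl : n = 3 * a + r + 2 := by omega
  refine Nat.div_eq_of_lt_le ?_ ?_
  · interval_cases r <;> nlinarith
  · interval_cases r <;> nlinarith

variable (K) in
lemma almostNondefective_three_of_mod_six_one {n j : ℕ} (hj : 1 ≤ j) (hn : n = 6 * j) :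
    AlmostNondefective K n 3 := by
  rw [AlmostNondefective, show 3 - 1 = 2 from rfl,
    div_eq_of_mod_three (m := 2 * j) (r := 1) (by omega) (by norm_num) (by omega)]
  have hb : 3 * j * (4 * j + 1) + (4 * j + 1) * n ≤ (n + 1) ^ 2 := by subst hn; nlinarith
  constructor
  · refine (nondefective_three_of_odd (h := 3 * j) (x := 4 * j + 1) (by omega) (by omega) (by omega)
      (by omega) hb).mono (three_mul_mul_le (by omega) hb) ?_
    subst hn
    nlinarith
  · refine (corankLE_three_zero_of_odd (h := 3 * j) (x := 4 * j + 1) (y := 3 * j + 1) (by omega)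
      (by omega) (by omega) (by omega) (by omega) ?_ ?_).mono ?_ le_rfl
    · subst hn; nlinarith
    · rw [show n + 1 - (3 * j + 1) = 3 * j by omega]
      nlinarith
    · subst hn; nlinarith

variable (K) in
lemma almostNondefective_three_of_mod_six_three {n j : ℕ} (hn : n = 6 * j + 2) :
    AlmostNondefective K n 3 := by
  rw [AlmostNondefective, show 3 - 1 = 2 from rfl,
    div_eq_of_mod_three (m := 2 * j + 1) (r := 0) (by omega) (by norm_num) (by omega)]
  constructor
  · have hp := (pieceCorankLE_three_of_three_mul (K := K) j).change (3 * j * (4 * j + 2))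
    have hN : 3 * (2 * j + 1) = n + 1 := by omega
    rw [hN] at hp
    have := corankLE_three (h := 3 * j) (x := 4 * j + 2) (by omega) (by omega) (by omega) hp
    refine this.mono (le_of_eq ?_) (le_of_eq ?_)
    · subst hn; ring
    · subst hn
      have e1 : 3 * ((2 * j + 1) * (2 * j)) + (2 * j + 1) * 2 - 3 * j * (4 * j + 2) = 4 * j + 2 :=
        Nat.sub_eq_of_eq_add (by ring)
      have e2 : 3 * j * (4 * j + 2) + (6 * j + 2 + 1) - (4 * j + 2) = 12 * j ^ 2 + 8 * j + 1 :=
        Nat.sub_eq_of_eq_add (by ring)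
      have e3 : 6 * j + 2 + 1 - (4 * j + 2) = 2 * j + 1 := by omega
      rw [e1, e2, e3, Nat.sub_eq_of_eq_add
        (show (2 * j + 1) * (6 * j + 2 + 1) = (4 * j + 2) + (12 * j ^ 2 + 8 * j + 1) by ring)]
      exact (Nat.sub_eq_of_eq_add (by ring)).symm
  · refine (corankLE_three_zero_of_odd (h := 3 * j + 1) (x := 4 * j + 2) (y := 6 * j + 3) (by omega)
      (by omega) (by omega) (by omega) (by omega) ?_ ?_).mono ?_ le_rfl
    · subst hn; nlinarith
    · rw [show n + 1 - (6 * j + 3) = 0 by omega]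
      simp
    · subst hn; nlinarith

variable (K) in
lemma almostNondefective_three_of_mod_six_five {n j : ℕ} (hn : n = 6 * j + 4) :
    AlmostNondefective K n 3 := by
  rw [AlmostNondefective, show 3 - 1 = 2 from rfl,
    div_eq_of_mod_three (m := 2 * j + 1) (r := 2) (by omega) (by norm_num) (by omega)]
  constructor
  · have hb : (3 * j + 2) * (4 * j + 3) + (4 * j + 3) * n ≤ (n + 1) ^ 2 := by subst hn; nlinarith
    refine (nondefective_three_of_odd (h := 3 * j + 2) (x := 4 * j + 3) (by omega) (by omega)
      (by omega) (by omega) hb).mono (three_mul_mul_le (by omega) hb) ?_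
    subst hn
    nlinarith
  · have hp := (pieceCorankLE_three_of_three_mul_add_two (K := K) j).change
      ((3 * j + 1) * (4 * j + 4))
    have hN : 3 * (2 * j + 1) + 2 = n + 1 := by omega
    rw [hN] at hp
    have := corankLE_three (h := 3 * j + 1) (x := 4 * j + 4) (by omega) (by omega) (by omega) hp
    refine this.mono (le_of_eq ?_) (le_of_eq ?_)
    · subst hn; ring
    · rw [sub_mul_sub_eq_zero (by omega) (by nlinarith) (by subst hn; nlinarith),
        Nat.sub_eq_zero_of_le (by nlinarith)]
      simp

variable (K) in
lemma almostNondefective_three {n : ℕ} (hn : 1 ≤ n) : AlmostNondefective K n 3 := by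
  obtain h | h | h | h : n % 2 = 1 ∨ n % 6 = 0 ∨ n % 6 = 2 ∨ n % 6 = 4 := by omega
  · exact almostNondefective_three_of_even K (h := (n + 1) / 2) (by omega)
  · exact almostNondefective_three_of_mod_six_one K (j := n / 6) (by omega) (by omega)
  · exact almostNondefective_three_of_mod_six_three K (j := n / 6) (by omega)
  · exact almostNondefective_three_of_mod_six_five K (j := n / 6) (by omega)

end ThreeFactors

section AllFactors

variable (K : Type*) [Field K] [CharZero K]

lemma almostNondefective_four {n : ℕ} (hn : 4 ≤ n) : AlmostNondefective K n 4 := by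
  obtain hp | hp : n % 2 = 1 ∨ n % 2 = 0 := by omega
  · obtain ⟨h, hh⟩ : ∃ h, n + 1 = 2 * h := ⟨(n + 1) / 2, by omega⟩
    have e : Nondefective K n 3 (h * (h + 1)) :=
      nondefective_three_of_even hh (by omega) (by omega) (by zify at *; nlinarith)
    refine AlmostNondefective.of_nondefective e ?_ ((Nat.div_lt_iff_lt_mul (by omega)).2 ?_)
    · obtain rfl : n = 2 * h - 1 := by omega
      obtain ⟨a, rfl⟩ := Nat.exists_eq_add_of_le' (show 1 ≤ h by omega)
      rw [show 2 * (a + 1) - 1 = 2 * a + 1 by omega]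
      ring_nf
      nlinarith [Nat.zero_le (a ^ 3), Nat.zero_le (a ^ 2)]
    · obtain ⟨a, rfl⟩ := Nat.exists_eq_add_of_le' (show 1 ≤ h by omega)
      obtain rfl : n = 2 * a + 1 := by omega
      nlinarith [Nat.zero_le (a ^ 3), Nat.zero_le (a ^ 2)]
  · obtain ⟨h, rfl⟩ : ∃ h, n = 2 * h := ⟨n / 2, by omega⟩
    have hb : h * (h + 2) + (h + 2) * (2 * h) ≤ (2 * h + 1) ^ 2 := by
      zify
      nlinarith [sq_nonneg ((h : ℤ) - 1)]
    have e : Nondefective K (2 * h) 3 (h * (h + 2)) :=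
      nondefective_three_of_odd rfl (by omega) (by omega) (by omega) hb
    refine AlmostNondefective.of_nondefective e (three_mul_mul_le rfl hb)
      ((Nat.div_lt_iff_lt_mul (by omega)).2 ?_)
    nlinarith [Nat.zero_le (h ^ 3), Nat.zero_le (h ^ 2)]

lemma almostNondefective_two_of_four_le {k : ℕ} (hk : 4 ≤ k) : AlmostNondefective K 2 k := by
  have h4 : AlmostNondefective K 2 4 :=
    .of_eq (m := 3) (almostNondefective_three K (n := 2) (by norm_num)).1 (by norm_num)
  have h5 : AlmostNondefective K 2 5 := .of_nondefective (m := 9) h4.1 (by norm_num) (by norm_num)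
  obtain rfl | hk : k = 4 ∨ 5 ≤ k := by omega
  · exact h4
  · exact h5.of_bound (by norm_num) (by norm_num) (by norm_num) hk

lemma almostNondefective_three_of_four_le {k : ℕ} (hk : 4 ≤ k) : AlmostNondefective K 3 k := by
  have h3 : Nondefective K 3 3 6 :=
    nondefective_three_of_even (h := 2) (x := 3) (by norm_num) (by norm_num) (by norm_num)
      (by norm_num)
  have h4 : AlmostNondefective K 3 4 := .of_nondefective h3 (by norm_num) (by norm_num)
  have h5 : AlmostNondefective K 3 5 := .of_eq (m := 16) h4.1 (by norm_num)
  obtain rfl | hk : k = 4 ∨ 5 ≤ k := by omega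
  · exact h4
  · exact h5.of_bound (by norm_num) (by norm_num) (by norm_num) hk

lemma almostNondefective {n k : ℕ} (hn : 1 ≤ n) (hk : 3 ≤ k) : AlmostNondefective K n k := by
  obtain rfl | hk4 : k = 3 ∨ 4 ≤ k := by omega
  · exact almostNondefective_three K hn
  obtain rfl | rfl | rfl | hn4 : n = 1 ∨ n = 2 ∨ n = 3 ∨ 4 ≤ n := by omega
  · exact almostNondefective_one (almostNondefective_three K le_rfl).1 hk
  · exact almostNondefective_two_of_four_le K hk4
  · exact almostNondefective_three_of_four_le K hk4
  · refine (almostNondefective_four K hn4).of_bound (by norm_num) hn ?_ hk4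
    norm_num
    nlinarith [Nat.mul_le_mul hn4 hn4]

end AllFactors

section Duality

variable {K : Type*} [Field K]

instance (n k : ℕ) : FiniteDimensional K (⨂[K] _ : Fin k, (Fin (n + 1) → K)) :=
  .of_basis (Basis.piTensorProduct fun _ : Fin k => Pi.basisFun K (Fin (n + 1)))

lemma finrank_piTensorProduct (n k : ℕ) :
    finrank K (⨂[K] _ : Fin k, (Fin (n + 1) → K)) = (n + 1) ^ k := by
  rw [finrank_eq_card_basis (Basis.piTensorProduct fun _ : Fin k => Pi.basisFun K (Fin (n + 1)))]
  simp

lemma finrank_form (n k : ℕ) : finrank K (Form K (Fin (n + 1) → K) k) = (n + 1) ^ k := by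
  rw [← finrank_piTensorProduct (K := K), ← Subspace.dual_finrank_eq (V := ⨂[K] _ : Fin k, _)]
  exact (PiTensorProduct.lift (R := K) (s := fun _ : Fin k => Fin (n + 1) → K)
    (E := K)).finrank_eq

lemma map_tangentAnn {n k : ℕ} {S : Type*} (p : S → Fin k → Fin (n + 1) → K) :
    (tangentAnn (K := K) p).map (PiTensorProduct.lift (R := K)
        (s := fun _ : Fin k => Fin (n + 1) → K) (E := K)).toLinearMap
      = (⨆ j, segreTangent K (fun _ : Fin k => n) (p j)).dualAnnihilator := by
  ext φ
  obtain ⟨f, rfl⟩ := (PiTensorProduct.lift (R := K)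
        (s := fun _ : Fin k => Fin (n + 1) → K) (E := K)).surjective φ
  simp only [segreTangent, segreG, Submodule.dualAnnihilator_iSup_eq, Submodule.mem_iInf,
    Submodule.mem_dualAnnihilator, LinearMap.mem_range, forall_exists_index,
    forall_apply_eq_imp_iff]
  constructor
  · rintro ⟨g, hg, hgf⟩ j i w
    obtain rfl := (PiTensorProduct.lift (R := K)
        (s := fun _ : Fin k => Fin (n + 1) → K) (E := K)).injective hgf
    exact (PiTensorProduct.lift.tprod _).trans (hg j i w)
  · intro h
    exact ⟨f, fun j i w => (PiTensorProduct.lift.tprod _).symm.trans (h j i w), rfl⟩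

lemma finrank_iSup_segreTangent_add {n k : ℕ} {S : Type*} (p : S → Fin k → Fin (n + 1) → K) :
    finrank K (⨆ j, segreTangent K (fun _ : Fin k => n) (p j) :
        Submodule K (⨂[K] _ : Fin k, (Fin (n + 1) → K)))
      + finrank K (tangentAnn (K := K) p) = (n + 1) ^ k := by
  have h1 := Subspace.finrank_add_finrank_dualAnnihilator_eq
    (⨆ j, segreTangent K (fun _ : Fin k => n) (p j) :
        Submodule K (⨂[K] _ : Fin k, (Fin (n + 1) → K)))
  have h2 := LinearEquiv.finrank_map_eq (PiTensorProduct.lift (R := K)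
        (s := fun _ : Fin k => Fin (n + 1) → K) (E := K)) (tangentAnn (K := K) p)
  rw [map_tangentAnn] at h2
  rw [← h2, h1, finrank_piTensorProduct]

lemma CorankLE.exists_ne_zero {n k s e : ℕ} (h : CorankLE K (Fin (n + 1) → K) k s e) :
    ∃ p : Fin s → Fin k → Fin (n + 1) → K, (∀ j i, p j i ≠ 0) ∧
      finrank K (tangentAnn (K := K) p) ≤ e := by
  obtain ⟨p, hp⟩ := h
  exact ⟨fun j => replaceZero 1 (p j), fun j i => replaceZero_ne_zero one_ne_zero _ _,
    (Submodule.finrank_mono (tangentAnn_replaceZero_le 1 p)).trans hp⟩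

lemma Nondefective.exists_finrank_eq {n k s : ℕ} (h : Nondefective K n k s)
    (hs : s * (n * k + 1) ≤ (n + 1) ^ k) :
    ∃ p : Fin s → Fin k → Fin (n + 1) → K, (∀ j i, p j i ≠ 0) ∧
      finrank K (⨆ j, segreTangent K (fun _ : Fin k => n) (p j) :
        Submodule K (⨂[K] _ : Fin k, (Fin (n + 1) → K))) = s * (n * k + 1) := by
  obtain ⟨p, hp0, hp⟩ := CorankLE.exists_ne_zero h
  refine ⟨p, hp0, ?_⟩
  have h1 := finrank_iSup_segreTangent_add p
  have h2 := finrank_form_le_finrank_tangentAnn_add_mul (K := K) (N := n + 1) (by simp) (by omega) p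
  rw [finrank_form, Nat.add_sub_cancel, mul_comm k n] at h2
  omega

lemma CorankLE.exists_iSup_eq_top {n k s : ℕ} (h : CorankLE K (Fin (n + 1) → K) k s 0) :
    ∃ p : Fin s → Fin k → Fin (n + 1) → K, (∀ j i, p j i ≠ 0) ∧
      (⨆ j, segreTangent K (fun _ : Fin k => n) (p j))
        = (⊤ : Submodule K (⨂[K] _ : Fin k, (Fin (n + 1) → K))) := by
  obtain ⟨p, hp0, hp⟩ := h.exists_ne_zero
  refine ⟨p, hp0, Submodule.eq_top_of_finrank_eq ?_⟩
  have h1 := finrank_iSup_segreTangent_add p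
  rw [finrank_piTensorProduct]
  omega

lemma sub_mod_eq_mul_div {n k : ℕ} (hk : 1 ≤ k) (d : ℕ) :
    (n + 1) ^ k / d - (n + 1) ^ k / d % (n + 1) = (n + 1) * ((n + 1) ^ (k - 1) / d) := by
  obtain ⟨j, rfl⟩ := Nat.exists_eq_add_of_le' hk
  have h : (n + 1) ^ (j + 1) / d / (n + 1) = (n + 1) ^ j / d := by
    rw [Nat.div_div_eq_div_mul, mul_comm d, ← Nat.div_div_eq_div_mul, pow_succ,
      Nat.mul_div_cancel _ (Nat.succ_pos n)]
  rw [Nat.add_sub_cancel, ← h]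
  have := Nat.div_add_mod ((n + 1) ^ (j + 1) / d) (n + 1)
  omega

end Duality

end SegreSecant

/-- Let `X = (Pⁿ)^k` with `k ≥ 3`, `n ≥ 1`, and set
`s_k = ⌊(n+1)^k / (nk+1)⌋` and `δ_k = s_k % (n+1)`.
(i) If `s ≤ s_k − δ_k` then there are `s` points whose tangent spaces span a subspace of
the expected dimension `s(nk+1)`;
(ii) if `s ≥ s_k − δ_k + n + 1` then there are `s` points whose tangent spaces span the
whole tensor space `(K^{n+1})^{⊗k}`. -/
theorem tensor_powers_Pn_secants
    (K : Type*) [Field K] [CharZero K] (k n : ℕ) (hk : 3 ≤ k) (hn : 1 ≤ n) (s : ℕ) :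
    (s ≤ (n + 1) ^ k / (n * k + 1) - ((n + 1) ^ k / (n * k + 1)) % (n + 1) →
      ∃ p : Fin s → ∀ _ : Fin k, Fin (n + 1) → K,
        (∀ j i, p j i ≠ 0) ∧
        Module.finrank K ((⨆ j, segreTangent K (fun _ : Fin k => n) (p j))
            : Submodule K (⨂[K] _ : Fin k, (Fin (n + 1) → K)))
          = s * (n * k + 1)) ∧
    ((n + 1) ^ k / (n * k + 1) - ((n + 1) ^ k / (n * k + 1)) % (n + 1) + n + 1 ≤ s →
      ∃ p : Fin s → ∀ _ : Fin k, Fin (n + 1) → K,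
        (∀ j i, p j i ≠ 0) ∧
        (⨆ j, segreTangent K (fun _ : Fin k => n) (p j))
          = (⊤ : Submodule K (⨂[K] _ : Fin k, (Fin (n + 1) → K)))) := by
  have hA := SegreSecant.almostNondefective K hn hk
  have hle := SegreSecant.mul_pow_div_mul_le (n := n) (k := k) (by omega)
  rw [SegreSecant.sub_mod_eq_mul_div (by omega), add_assoc, ← Nat.mul_succ]
  constructor
  · intro hs
    exact SegreSecant.Nondefective.exists_finrank_eq (SegreSecant.Nondefective.mono hA.1 hle hs)
      ((Nat.mul_le_mul_right _ hs).trans hle)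
  · intro hs
    exact SegreSecant.CorankLE.exists_iSup_eq_top (SegreSecant.CorankLE.mono hA.2 hs le_rfl)
end

section
/- For the Segre variety X = (P²)⁵ (five factors, so the tensor space is (K³)^{⊗5} of dimension 243), the typical tensor rank satisfies R(2,2,2,2,2) = 23: there exist 23 points p₁,…,p₂₃ (pure tensors of nonzero vectors in (K³)^{⊗5}) with Σ_j T_{p_j} = (K³)^{⊗5}, and no 22 points have this property; moreover T(2,2,2,2,2; 22; 0,0,0,0,0) holds, i.e. there exist 22 points p₁,…,p₂₂ with dim(Σ_j T_{p_j}) = 22·11 = 242. -/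
open scoped TensorProduct

section DimensionBounds

variable {K : Type*} [Field K] {k : ℕ} {n : Fin k → ℕ}

theorem tprod_mem_segreG (v : ∀ i, Fin (n i + 1) → K) (i : Fin k) :
    PiTensorProduct.tprod K v ∈ segreG K n v i :=
  ⟨v i, by simp⟩

theorem finrank_segreG_le (v : ∀ i, Fin (n i + 1) → K) (i : Fin k) :
    Module.finrank K (segreG K n v i) ≤ n i + 1 :=
  (LinearMap.finrank_range_le _).trans (by simp)

theorem finrank_piTensorProduct_fin :
    Module.finrank K (⨂[K] i, (Fin (n i + 1) → K)) = ∏ i, (n i + 1) := by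
  rw [Module.finrank_eq_card_basis (Basis.piTensorProduct fun i => Pi.basisFun K (Fin (n i + 1)))]
  simp

instance finiteDimensional_piTensorProduct_fin :
    FiniteDimensional K (⨂[K] i, (Fin (n i + 1) → K)) :=
  (Basis.piTensorProduct fun i => Pi.basisFun K (Fin (n i + 1))).finiteDimensional_of_finite

theorem tprod_ne_zero_of_forall_ne_zero {v : ∀ i, Fin (n i + 1) → K} (hv : ∀ i, v i ≠ 0) :
    PiTensorProduct.tprod K v ≠ 0 := by
  choose a ha using fun i => Function.ne_iff.mp (hv i)
  intro h
  have h' := Basis.piTensorProduct_repr_tprod_apply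
    (fun i => Pi.basisFun K (Fin (n i + 1))) v a
  rw [h] at h'
  exact Finset.prod_ne_zero_iff.mpr (fun i _ => ha i) (by simpa using h'.symm)

/-- Each summand of the tangent space contributes at most `nᵢ` new dimensions beyond the line
spanned by the point itself. -/
theorem finrank_span_tprod_sup_segreG_le {v : ∀ i, Fin (n i + 1) → K} (hv : ∀ i, v i ≠ 0)
    (S : Finset (Fin k)) :
    Module.finrank K
      ((K ∙ PiTensorProduct.tprod K v) ⊔ S.sup (segreG K n v) :
        Submodule K (⨂[K] i, (Fin (n i + 1) → K))) ≤ 1 + ∑ i ∈ S, n i := by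
  have hw := tprod_ne_zero_of_forall_ne_zero hv
  induction S using Finset.induction_on with
  | empty =>
    rw [Finset.sup_empty, sup_bot_eq, finrank_span_singleton hw, Finset.sum_empty, add_zero]
  | insert i S hi ih =>
    set A := (K ∙ PiTensorProduct.tprod K v) ⊔ S.sup (segreG K n v) with hA
    have hsup : (K ∙ PiTensorProduct.tprod K v) ⊔ (insert i S).sup (segreG K n v)
        = A ⊔ segreG K n v i := by
      rw [Finset.sup_insert, hA, sup_assoc, sup_comm (S.sup _)]
    have hle : (K ∙ PiTensorProduct.tprod K v) ≤ A ⊓ segreG K n v i :=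
      le_inf le_sup_left ((Submodule.span_singleton_le_iff_mem _ _).mpr (tprod_mem_segreG v i))
    have h1 := Submodule.finrank_mono hle
    rw [finrank_span_singleton hw] at h1
    have h2 := Submodule.finrank_sup_add_finrank_inf_eq A (segreG K n v i)
    have h3 := finrank_segreG_le v i
    rw [hsup, Finset.sum_insert hi]
    omega

theorem finrank_segreTangent_le {v : ∀ i, Fin (n i + 1) → K} (hv : ∀ i, v i ≠ 0) :
    Module.finrank K (segreTangent K n v) ≤ 1 + ∑ i, n i := by
  refine le_trans (Submodule.finrank_mono ?_)
    (finrank_span_tprod_sup_segreG_le hv Finset.univ)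
  rw [Finset.sup_univ_eq_iSup]
  exact le_sup_right

theorem finrank_iSup_le_card_mul {V : Type*} [AddCommGroup V] [Module K V]
    [FiniteDimensional K V] {s d : ℕ} (T : Fin s → Submodule K V)
    (hT : ∀ j, Module.finrank K (T j) ≤ d) :
    Module.finrank K (⨆ j, T j : Submodule K V) ≤ s * d := by
  induction s with
  | zero => simp
  | succ s ih =>
    have h1 := ih (fun j => T j.succ) (fun j => hT j.succ)
    have h2 : (⨆ j, T j) = T 0 ⊔ ⨆ j : Fin s, T j.succ := by
      apply le_antisymm
      · refine iSup_le fun j => ?_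
        cases j using Fin.cases with
        | zero => exact le_sup_left
        | succ j => exact le_sup_of_le_right (le_iSup (fun j : Fin s => T j.succ) j)
      · exact sup_le (le_iSup T 0) (iSup_le fun j => le_iSup T j.succ)
    have h3 := Submodule.finrank_add_le_finrank_add_finrank (T 0) (⨆ j : Fin s, T j.succ)
    rw [h2, add_mul]
    have := hT 0
    omega

theorem finrank_iSup_segreTangent_le {s : ℕ} {p : Fin s → ∀ i, Fin (n i + 1) → K}
    (hp : ∀ j i, p j i ≠ 0) :
    Module.finrank K (⨆ j, segreTangent K n (p j) : Submodule K (⨂[K] i, (Fin (n i + 1) → K)))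
      ≤ s * (1 + ∑ i, n i) :=
  finrank_iSup_le_card_mul _ fun j => finrank_segreTangent_le (hp j)

theorem tprod_mem_segreTangent {v x : ∀ i, Fin (n i + 1) → K} {i : Fin k}
    (h : ∀ j, j ≠ i → x j = v j) : PiTensorProduct.tprod K x ∈ segreTangent K n v := by
  refine Submodule.mem_iSup_of_mem i ⟨x i, ?_⟩
  rw [MultilinearMap.toLinearMap_apply]
  congr 1
  funext j
  by_cases hj : j = i
  · subst hj; simp
  · simp [hj, h j hj]

end DimensionBounds

/-- Triples of elements of a type. -/
abbrev Triple (α : Type*) := α × α × α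

/-- A triple of booleans viewed as a vector of zeros and ones. -/
def boolVec (R : Type*) [Zero R] [One R] (u : Triple Bool) : Fin 3 → R :=
  ![bif u.1 then 1 else 0, bif u.2.1 then 1 else 0, bif u.2.2 then 1 else 0]

theorem map_boolVec {R S : Type*} [Semiring R] [Semiring S] (f : R →+* S)
    (u : Triple Bool) (a : Fin 3) : f (boolVec R u a) = boolVec S u a := by
  obtain ⟨_ | _, _ | _, _ | _⟩ := u <;> fin_cases a <;> simp [boolVec]

/-- The binary digit of `m` in position `c`, as an element of the field with two elements. -/
def bit₂ (c m : ℕ) : ZMod 2 := bif m.testBit c then 1 else 0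

theorem bit₂_xor (c m m' : ℕ) : bit₂ c (m ^^^ m') = bit₂ c m + bit₂ c m' := by
  simp only [bit₂, Nat.testBit_xor]
  cases m.testBit c <;> cases m'.testBit c <;> decide

theorem bit₂_two_pow (c r : ℕ) : bit₂ c (2 ^ r) = if r = c then 1 else 0 := by
  by_cases h : r = c <;> simp [bit₂, h]

/-- The entry of a triple at a given index. -/
def tripleGet {α : Type*} (t : Triple α) : Fin 3 → α := ![t.1, t.2.1, t.2.2]

/-- Contraction of a triple with a vector of zeros and ones, with bitwise exclusive or as
addition. -/
def xorContract {α : Type} (f : α → ℕ) (u : Triple Bool) (t : Triple α) : ℕ :=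
  (bif u.1 then f t.1 else 0) ^^^ ((bif u.2.1 then f t.2.1 else 0) ^^^
    (bif u.2.2 then f t.2.2 else 0))

theorem bit₂_xorContract {α : Type} (f : α → ℕ) (u : Triple Bool) (t : Triple α) (c : ℕ) :
    bit₂ c (xorContract f u t) = ∑ a, boolVec (ZMod 2) u a * bit₂ c (f (tripleGet t a)) := by
  have h0 : bit₂ c 0 = 0 := by simp [bit₂]
  obtain ⟨_ | _, _ | _, _ | _⟩ := u <;>
    simp [xorContract, Fin.sum_univ_three, boolVec, tripleGet, bit₂_xor, h0, add_assoc]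

/-- Binary codes of 23 points of `(P²)⁵`: the `i`-th vector of the point with code `c` is
`(1, x, y)` where `x` and `y` are the binary digits of `c` in positions `2i` and `2i+1`. -/
def pointCodes : List ℕ :=
  [529, 997, 516, 975, 642, 368, 325, 144, 119, 953, 637, 726,
    44, 830, 415, 217, 760, 166, 483, 282, 11, 872, 384]

/-- The `i`-th vector of the `j`-th point. -/
def pointVec (j i : ℕ) : Triple Bool :=
  (true, (pointCodes.getD j 0).testBit (2 * i), (pointCodes.getD j 0).testBit (2 * i + 1))

/-- The `i`-th vector of the `r`-th tangent tensor. Each point has 11 such tensors: the point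
itself, and those obtained by replacing one of its five vectors by the second or third standard
basis vector. -/
def tangentVec (r i : ℕ) : Triple Bool :=
  if r % 11 = 2 * i + 1 then (false, true, false)
  else if r % 11 = 2 * i + 2 then (false, false, true)
  else pointVec (r / 11) i

/-- A matrix over the field with two elements, inverse to the matrix of coordinates of the
tangent tensors: rows are indexed by the coordinates of a tensor and written in binary. -/
def inverseRows : Triple (Triple (Triple (Triple (Triple ℕ)))) :=
    (((((11794976666878404910166819454464750017492252686771092189526068559872,
    5472731661821487676249155229487815599854349328589053981968084771388609715,
    11794976666878404910166819454464750017492252686771092189526097920000),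
    (5304003862488856655087285527761204379901735314028802086499750719889876992,
    168739594309349690445145373868444768598269264403915748845790784559611059,
    889514552000466333723467507773352076751263284402021571653431406442586878),
    (11794976666878404910166819454464750017492257673590098099871414222848,
    12540119920935024994582345232459489663164284916086542995448599231213425843,
    11794976666878404910166819454464750017492257673590098187832373805056)),
    ((11794976666878404910166819454464750017492291523513047309488305995776,
    7067400054093016338315553402773326961721550114425633347913060957953196032,
    11794976666878404910166819454464750017492291523513047309488335355907),
    (5304003862488856655087285527761204379901735314009459273385916653094578176,
    12371392121604402645975799268577305895827097354842308005529797627679352832,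
    58676638924386670598105591648809181095851918554971836848629393282564099),
    (11794976666878404910166819454464750017492296359216325768005004820480,
    11794979479019982363399801652898411614526850773081977210230947184640,
    11794976666878404910166819454464750017492450950605509076671679954947)),
    ((11794976666878404910166819579688661044397607241292947724416770375680,
    12540119920935426729093409980028511266634138582204765848315047906766312627,
    12423640984353160373172753409023125105937915135560464407769319122979940936),
    (11794976666878404910166819579688661044397665420866499451316531625984,
    12540119920935426729093409980028511266634138582185574134751735807103030451,
    13254477936322721761660247135542425025523377857112056485245789303889086646),
    (11794976666878404910166819579688661044397616912699504641450168025088,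
    12540119920935426729093409980028511266634138582137217122719737723038028979,
    11794976666880033186678989586600666788114119009883113937148644950019))),
    (((11794976666878404910166819454464750017492252686771092189521769398272,
    5472731661821487676249155229487815599854349328589053981968084769241126067,
    11794976666878404910166819454464750017492252686771092189521802952704),
    (7233499923359608206174419355494710362904918734707630730647975977372509773,
    12374075761974122213273253890294778347105797318169794835342552537638580990,
    13420039818702363458673590733038673501546767684134625405373527878663826611),
    (13814216759886727387669159932101556986832317281053176359619831085141857851,
    7187392741931540792933040226584733959654570961877321538565912308391496961,
    13814216759886727387669159932101556986832317281053176359619778309619717691)),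
    ((64451945253435676867847082517946107387333922110923474043724246286336,
    552139707743245152130418748058843644274238453803650070560510235763539971,
    64451945253435676867847082517946107387333922110923474043724418252803),
    (5304056519453801706320477727243114349121389398190036483538371111626473472,
    7129984469964098066734317773054698417173865524126185239398467920308406562,
    13013774200929468974002365099037064956862608495672056305744527149930055970),
    (13814271944350313990301625740983921670430411149067482913265709231866910267,
    12986116245216669017116426919179033776063386395905009968332481233101207841,
    915290355779767499511610355042603520400890963457203460389205540180801305)),
    ((11794976666878404910166819498020892983372376010083041940788100464640,
    7622139989124527297741841338488783868228640618174814423130936618138418939,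
    12423640984353160373172753409023043438169854110329233197863535502639917640),
    (12537491990868156476818029235655350322061886676932484515429866279281780301,
    7187310802377771381000813931676743047767133452125377799844375605641630103,
    13789342847658222102889879547277730168433442294650112955104816441580261338),
    (13814216759886726406872013777932644081347254024736962350682951966651061819,
    5804015275016534318550007536106389465117086223471355997854876782974563360,
    915238542955018235714547995878075903672475501930204480875025005357250329))),
    (((353893661597776002001909591729043239075840,
    7515218950179450407408192712715824759930754561847426793534990291702333179,
    353893661597776002001909591729043306184704),
    (113934841687605784057565416752407965450558215652138438695703469436708864,
    9451600323693164974887108345161084782690152396329259285959765255403804633,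
    2936319865982620963670556032560464295017931865136714505540893340411372508),
    (113943266667298841566330742251683905890298479776152837796996782688829440,
    11546215576109440073857021375444319703972474170582401733528535930643772451,
    3817198770234852889221071125986634821492736188401311930555155679798624546)),
    ((56026961919951101932013640482921562536077862024283292987319520329728,
    5908392432982466484623100762105726440505600978123356264094173443842271816,
    12423576534053411507196875681263242696543263957018845065525033607360309835),
    (113934841687605784057518648700013376557175697715881968613462983097460736,
    2264270361879835031169159087191506114598488371358655505025261850322682440,
    8945096375270967358329758726675621868507905035044970278040148793681144395),
    (113890609698712284294373061988440755443194382634136682483405653190639616,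
    2760710333695704611581042788006905997309409473234386884979176029647011840,
    1877286801303701310624796583981894795174991034271129821279466400906215427)),
    ((441005947529536248648533491231575901208576,
    12426188446776539119202731453638852938357539645683061696127733551153632435,
    6010747729291457018617049065674758317670400),
    (113934841683964278210361878578875330088242777687580036334113964301484032,
    7187341875311357726197681178689545824413245845603221659819973488812316049,
    6418250897938460394431390365084880489847210022613289660905382224712180700),
    (113943266667297860769184588081502427741353964863160549317701686960062464,
    12426188235326442157127374937555352149704319077864122249624791678716048419,
    5587496708186633476897745536233380977692212593563480428327533521485168929)))),
    ((((7622192653487841037040277219786053620859118511284692678712403677303946482,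
    5369194092072188902794025938566125390332741306503292251964286381727194765,
    7622192653487841037040277219786053620859118511284692678712403677341695187),
    (993636960691336820809191431473267384408096311079554230643495252496377563,
    13847724656009050701548094555701539923778436124403449844669351898117358756,
    13413195611855341440227283878141371331571689033143450125943313023179694230),
    (7274494800365024482715291729167542490485182589721107967601819301468727900,
    7723128160098364990985919864002791812509951158166641474856340540472011305,
    7274494800365024482715291729167542490485182589721107967601784117067278973)),
    ((7622192653487841037040277219786053620859118511323529420667523639541381363,
    7184742801544615020823906895497852692260627693565381399604102524790753342,
    7622192653487841037040277219786053620859118511323529420667523639579130064),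
    (993636960691336820808396374582559373220593506549446038612281006047782619,
    6228253552847580493912050456522625518663999604866566792226356191198735287,
    12582383842890853175010131570248506392221260252236189466279805214352474859),
    (7274494800365024482715291729167542490485182589682271225646699339231293021,
    103549227031287821161253189979145070116523523985855128050136508772550331,
    7274494800365024482715291729167542490485182589527377605008539791820615551)),
    ((7622184228508172989765904241590367166316087839340796635542864182637108466,
    12540119920935426729093409979972759403657460607107046069012648568690335474,
    5910928095499142958070276731648039062781832449341121607168837421863565050),
    (7622184228508172989765202720804448333588970090713770694800047775576365299,
    7619584001229148412498953310670055167779882587217296723178397255462397778,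
    6736566082299574572287126657374279175698848918933837045285963615158947972),
    (6629535093819273800512263101832903335483483388009984623551346346888820165,
    1390683475202226153345359743537182091802741529945418668976535152780920849,
    12988718733404635126114084989023983005783780954530239217915009929377880133))),
    (((19805292851918035923395049705665190086914899752589785955425964785671,
    12986068859671337947489645498469646133378125175079387386092638651870519928,
    19805292851918035923395049705665190086914899752589785955426010923046),
    (6674298465026115849255810989318807568589826760634260739592902558219113571,
    8162065056843534701583463752882159411159052734165353991379740177589122588,
    8609939279597432365503349156432874869123004118138372575418163584252793390),
    (12968029232275389739531955706195583844041563516599148379522702703140802788,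
    6735623693780144490311420400244834433354530396558003682799912548620230424,
    6733077038662462963447827025467117495244067425120105614620310588165616710)),
    ((12537458718765977037320326100783615938950875073406315989160698179412191819,
    448629942091682656101401939002147144424253698680116222854323517863807028,
    12537458718765977037320326100783615938950875073406315989160698179521243745),
    (6674283300052519187651585620895660903732526468640324724775281246490997859,
    993726890750957385578217398983962181149798707391512923574328148575806108,
    5320861678481026722810598977789857022036108545872388317466276306417570171),
    (12967974047808238330922780357321802130663961043595531044287588579556998373,
    6735571665391437057445733746350170391353132854458457502022745972426863385,
    8134475127393163626960149905592646785370334866518462050186821278257469541)),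
    ((24860282852008801836982587859308272486394735560897739548664969297927,
    68244020549206646198820700161751015792370728970624330114997248065543,
    12423653193996975696817908583861517505798261003395336165157659921325386311),
    (12537505898669009719120618223783692331488868577643708779609644827855964747,
    5369200194473247136390021520461744748611022574940102236056437777254104779,
    13789358440459407278933955873374891104674729005442883337732439744436437845),
    (942086448206642466550337493461057588736851898139586838035606769151258493,
    56245817692933893725102337425449846234071684376222365475256546634753,
    13896187651001012611010794186925020783038413414092660242617126730152226655))),
    (((7622196023481174430870251553162939498312952715927745496283963815255227634,
    5368326345939665187375534789575003458166716943132333510241618604524347021,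
    5368341083078480556096848346973909489831848818603817840459865241197780618),
    (12413241766301880113197686238238434113208012888699419137757086607268129368,
    2361791104376690458278454521323732459453057076922244930915506912274843909,
    3359873959489141313770004001280360176101224321960691431596064748936004604),
    (1048487807065115630932035437972753332124576988219877193579072846441359071,
    5971687242716658215118086098331047545711032194508596567844190475747694003,
    7079619110785960562119499313915541087083992104787161379038525922154836167)),
    ((7622139996519254479786325239694727194364283811284461213295106552378308851,
    7185655676462375548978707165596290851042926460958823075071312569270388798,
    7079541185834582294360081705660571181900495638169120971812289793960374480),
    (12413241766301880113192354680265450979362405846408211704003222097500318296,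
    10708986516728282582057141579579084678123283031221169038435187077510203300,
    9494716779025490010859421586816913018379875442458609406347099899283696251),
    (1048432624247033585620869207349618890637137364557666270513026341843641054,
    12707793579383449714738916733413059123194287139273926778182497027508320545,
    12760199983647166164063163018080615675442166695577141443091225284748956774)),
    ((7622196023484839868167821253056175938608050277363167632273790417427373298,
    12426188447599291398132671688401023103661302520736860790296061835982954226,
    7622196023484839868455164166962949468720730401492989585864146980090551459),
    (7515162928147666202987724785440977903336494691848309115828101402145200371,
    12986111089862567135442547811774080063446596661092219970386503399649150688,
    14035155988789532764796104796694145245200423892911333616102203692746152830),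
    (6736456135232607710724239307441332526531814237172489245381896543504725445,
    1504507315262514887343037387263990877111332033046980431948317884965472273,
    7843024152705403377973277196377809827057120780110264561946290550497491430)))),
    ((((7622216243441174793850097553423900869374360167784060492121595599732227314,
    119999776571527411042963529700432792760537697806453812375968637400119942,
    7622216243441174793850097553423900869374360167784060492117074407948172530),
    (8569049611191187704700103434530009044506435648590512691357103451246845496,
    13253984707295215691403869651641284362675782475674158098416834618644155134,
    12988713678438739104597088830421112833395317781649555578190342550937294022),
    (7622216243441174793850097553423900869374360167789047311145502751401327858,
    7187388035685064729376153532672106856070473285313916463877310987171003014,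
    7622216243441174793850097553423900869374360167789047311141087112733539570)),
    ((5804008317000463126449739100221809135341406744284348974823923312634393272,
    117344064007301422029819372510891551804621557616453841947330182345711743,
    5804008317000463126449739100221809135341406744284348974819402120791618236),
    (5806987388056057333219851585395646535469814189332557862592972431263275785,
    5910590304129891006713523386995408347362836637529413918583133257425843311,
    451232222949416297122634610035097679444398679221133282406844175162290954),
    (5804008317000463126449739100221809135341406744279966618745817088199520952,
    12988668183413090142439907657526626246651328595684766900417850386369387102,
    5804008317000463126449739100221809135341406744125375229558726101524837052)),
    ((7622330823214560204726671906203725541298336880183739265881187326969396466,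
    2790986511607447866293745777788946320482784491520478963542366318172921,
    5910955529347305769249657535891372086328021807936883573237595613702674109),
    (8558285851061782370829356944542616352647514349992894250448046230945544073,
    8558337717327465640655650076510787384332199961419609591048845725461626513,
    565085348454372979700792404032870228500838036238349769714379904395802253),
    (7622330823214561970161534983707690370114112157349590201243569922200190194,
    12986275224818523658812104039080241968102743694457730720909467712226985767,
    7622210714546114677835640196312874957707319231630737594241264111706586358))),
    (((8010316185039631013228230948098727523504620238809889786165492449287,
    7516079981007875694978792749600396850431941043734780269565835918119007978,
    8010316185039631013228230948098727523504620238809894307357360390151),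
    (952017824713560434741984240718031123844208685608670498901385207623213773,
    6736116343848975668273252496713426254341611917657181478487047704335271570,
    5366588015090198010412919674540398368327711564098569727873550381411756083),
    (13814222229543888281402085615587487125059490256420493423200892480705533500,
    7187388035685064729376153532672106773658337576050170129002310477754790534,
    13814222229543888281402085615587487125059490256420493423205466450134046268)),
    ((62344876667785872530884782629589080203262876111542173889065155297280,
    12436516463487053629852980122859663962988406119056307647371388015899222621,
    62344876667785872530884782630612585760017261333678109846673018585092),
    (10832849983487740812353514194064807868571629090258659722118316193497521,
    565575045929366209455873191290347013100309423403051831738192366258253133,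
    7705800059515658006720241120108424317152430777230109728464791996769978515),
    (13814274049773388805683021308702076079232566003016894386137588424429540923,
    12986118108031298080475543920107358860867098676232203219337424558515324577,
    915295832841680266044186286896921984294074473554956603728103592822257438)),
    ((109110116186854551195317010278470511878261582652036714497528320491527,
    7622240614196464325476121339873808832138460891538930651467045755168440060,
    12423641767613329658066829485581935011557516082614792883409357425472334408),
    (941429299301379643247816506561508463202518155019727127686186709868094332,
    8126060831723749339415595246834329008271073122502035777471802327131406740,
    5884224683361955716666332359407581619606402067458606267997756838550782809),
    (13814107649770550733438216207661594013208255217510202430741877997046601276,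
    5804115374349545583598218542277124991688851712768337792754664065573418023,
    915239326215000776831996320111491055030756927198171090812617020659939097))),
    (((7622222983427841581510046220177672624282028577070166127264715875634789618,
    12874861841645802161454566831886184918442241009542883450726778386499604686,
    5366640921441783368874797158334641309746636270212500293998963235001507499),
    (448219451348694160460644332259391816379576207284297781737898927635829435,
    5919143730223160320594935195761394217042732321139637387636525325437615782,
    549635694612954243836324465886407142887584441408313781849711601882406944),
    (1387930440274039637013254020535850249053005556963811692925686932932948081,
    10863828319280938123918277833509096121337523474096179645125138845916894673,
    10003882801029934716193142449729983987725565527095095110539112742209901322)),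
    ((5803962822090462309763091299805766513666914378742200544410022539221562040,
    12872261631847502367984655063370394878893649676070966712183345812416399927,
    5473591450290356774287597139360986710951588550828640025966461447828716205),
    (1384270214728126231589783573075447106561897526907872522071990878408282567,
    6298772539725564353368067021081611819943853121501668838712056246369142616,
    12552210426523744863955014735119532431221541739744857916979797761498390808),
    (1387916545633589590742747475105229509756123832637660872423522543617472630,
    4348590732731537232462709691051935121767781401241133933186966414881035220,
    10521574647592846184224916234241108568446753632137508830474135383554888184)),
    ((7622222983427891602164500082790123775604280198485643136777761022528863474,
    116517786231637339485313761329355845431983143487882559561805682824387321,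
    7622223403854507085571753146245330151795072022763950452024447278662696181),
    (6629585643924559081511792027945097587128187936473517940469590370528817604,
    1387338117299126036843558368981045169407590767555954955054678033952537086,
    5452021154745488035298284131537445791109880345731546312707725249979947467),
    (1387930440274087499913986343975389590729864051782196770868288614429651057,
    5908447987282241526247656130322876844724808674873242601957483122282752072,
    6387921104866566850012745516437062239883632757777737171566870484286255926)))))

/-- The product of the `r`-th row of the coordinate matrix with the matrix `inverseRows`. -/
def rowMulInverse (r : ℕ) : ℕ :=
  xorContract (xorContract (xorContract (xorContract (xorContract id (tangentVec r 4))
    (tangentVec r 3)) (tangentVec r 2)) (tangentVec r 1)) (tangentVec r 0) inverseRows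

theorem rowMulInverse_eq : ∀ r : Fin 243, rowMulInverse r = 2 ^ (r : ℕ) := by
  decide +kernel

theorem tangentVec_eq_pointVec :
    ∀ r : Fin 243, ∃ i : Fin 5, ∀ j : Fin 5, j ≠ i → tangentVec r j = pointVec (r / 11) j := by
  decide +kernel

/-- The index set of the coordinates of a tensor with five factors of dimension three. -/
abbrev CoordIndex := Fin 3 × Fin 3 × Fin 3 × Fin 3 × Fin 3

/-- The multi-index corresponding to an element of `CoordIndex`. -/
def CoordIndex.toFun (q : CoordIndex) : Fin 5 → Fin 3 :=
  ![q.1, q.2.1, q.2.2.1, q.2.2.2.1, q.2.2.2.2]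

/-- The matrix of coordinates of the tangent tensors. -/
def coordMatrix (R : Type*) [CommSemiring R] : Matrix (Fin 243) CoordIndex R :=
  fun r q => ∏ i : Fin 5, boolVec R (tangentVec r i) (q.toFun i)

/-- The matrix over the field with two elements encoded by `inverseRows`. -/
def inverseMatrix : Matrix CoordIndex (Fin 243) (ZMod 2) :=
  fun q c => bit₂ c (tripleGet (tripleGet (tripleGet (tripleGet (tripleGet inverseRows
    q.1) q.2.1) q.2.2.1) q.2.2.2.1) q.2.2.2.2)

theorem coordMatrix_mul_inverseMatrix : coordMatrix (ZMod 2) * inverseMatrix = 1 := by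
  ext r c
  have h : bit₂ c (rowMulInverse r) = (coordMatrix (ZMod 2) * inverseMatrix) r c := by
    simp only [rowMulInverse, bit₂_xorContract, id, Matrix.mul_apply, Fintype.sum_prod_type,
      Finset.mul_sum]
    refine Finset.sum_congr rfl fun _ _ => Finset.sum_congr rfl fun _ _ =>
      Finset.sum_congr rfl fun _ _ => Finset.sum_congr rfl fun _ _ =>
      Finset.sum_congr rfl fun _ _ => ?_
    simp only [coordMatrix, inverseMatrix, CoordIndex.toFun, Fin.prod_univ_five, mul_assoc]
    rfl
  rw [← h, rowMulInverse_eq, bit₂_two_pow, Matrix.one_apply]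
  simp only [Fin.ext_iff]

theorem map_coordMatrix {R S : Type*} [CommSemiring R] [CommSemiring S] (f : R →+* S) :
    (coordMatrix R).map f = coordMatrix S := by
  ext r q
  simp [coordMatrix, map_boolVec]

theorem linearIndependent_coordMatrix (K : Type*) [Field K] [CharZero K] :
    LinearIndependent K (coordMatrix K).row := by
  let e : CoordIndex ≃ Fin 243 := Fintype.equivOfCardEq (by simp [CoordIndex])
  have hdet₂ : ((coordMatrix (ZMod 2)).submatrix id e.symm).det ≠ 0 := by
    refine Matrix.det_ne_zero_of_right_inverse
      (B := inverseMatrix.submatrix e.symm id) ?_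
    rw [Matrix.submatrix_mul_equiv, coordMatrix_mul_inverseMatrix, Matrix.submatrix_id_id]
  have hdetℤ : ((coordMatrix ℤ).submatrix id e.symm).det ≠ 0 := by
    intro h
    apply hdet₂
    rw [← map_coordMatrix (Int.castRingHom (ZMod 2)), Matrix.submatrix_map,
      ← RingHom.mapMatrix_apply, ← RingHom.map_det, h, map_zero]
  have hdet : ((coordMatrix K).submatrix id e.symm).det ≠ 0 := by
    rw [← map_coordMatrix (Int.castRingHom K), Matrix.submatrix_map,
      ← RingHom.mapMatrix_apply, ← RingHom.map_det]
    simpa using hdetℤ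
  exact LinearIndependent.of_comp (LinearMap.funLeft K K e.symm)
    (Matrix.linearIndependent_rows_of_det_ne_zero hdet)

/-- The `r`-th tangent tensor. -/
noncomputable def tangentTensor (K : Type*) [Field K] (r : Fin 243) :
    ⨂[K] _ : Fin 5, (Fin (2 + 1) → K) :=
  PiTensorProduct.tprod K fun i => boolVec K (tangentVec r i)

theorem linearIndependent_tangentTensor (K : Type*) [Field K] [CharZero K] :
    LinearIndependent K (tangentTensor K) := by
  let coords : (⨂[K] _ : Fin 5, (Fin (2 + 1) → K)) →ₗ[K] CoordIndex → K :=
    LinearMap.pi fun q =>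
      (Basis.piTensorProduct fun _ : Fin 5 => Pi.basisFun K (Fin (2 + 1))).coord q.toFun
  have h : coords ∘ tangentTensor K = (coordMatrix K).row := by
    ext r q
    simp [coords, tangentTensor, coordMatrix, Matrix.row]
  exact LinearIndependent.of_comp coords (h ▸ linearIndependent_coordMatrix K)

theorem tangentTensor_mem_segreTangent (K : Type*) [Field K] (r : Fin 243) :
    tangentTensor K r ∈
      segreTangent K (fun _ : Fin 5 => 2) fun i => boolVec K (pointVec (r / 11) i) := by
  obtain ⟨i, hi⟩ := tangentVec_eq_pointVec r
  exact tprod_mem_segreTangent (i := i) fun j hj => by rw [hi j hj]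

theorem boolVec_pointVec_ne_zero (K : Type*) [Field K] (j i : ℕ) :
    boolVec K (pointVec j i) ≠ 0 :=
  fun h => one_ne_zero (α := K) (congrFun h 0)

/-- For the Segre variety `X = (P²)⁵`, the typical tensor rank is `23`:
`23` is the least number of points (pure tensors of nonzero vectors in `(K³)^{⊗5}`) whose
tangent spaces span the whole `243`-dimensional space, and moreover
`T(2,2,2,2,2; 22; 0,…,0)` holds, i.e. there are `22` points whose tangent spaces span a
subspace of dimension `22·11 = 242`. -/
theorem P2_pow5_typical_rank
    (K : Type*) [Field K] [CharZero K] :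
    IsLeast {s : ℕ | ∃ p : Fin s → ∀ _ : Fin 5, Fin (2 + 1) → K,
        (∀ j i, p j i ≠ 0) ∧
        (⨆ j, segreTangent K (fun _ : Fin 5 => 2) (p j))
          = (⊤ : Submodule K (⨂[K] _ : Fin 5, (Fin (2 + 1) → K)))} 23 ∧
    ∃ p : Fin 22 → ∀ _ : Fin 5, Fin (2 + 1) → K,
      (∀ j i, p j i ≠ 0) ∧
      Module.finrank K ((⨆ j, segreTangent K (fun _ : Fin 5 => 2) (p j))
          : Submodule K (⨂[K] _ : Fin 5, (Fin (2 + 1) → K))) = 22 * 11 := by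
  have htensor : Module.finrank K (⨂[K] _ : Fin 5, (Fin (2 + 1) → K)) = 243 := by
    rw [finrank_piTensorProduct_fin (n := fun _ : Fin 5 => 2)]
    simp
  refine ⟨⟨⟨fun j i => boolVec K (pointVec j i), fun _ _ => boolVec_pointVec_ne_zero K _ _, ?_⟩,
    ?_⟩, fun j i => boolVec K (pointVec j i), fun _ _ => boolVec_pointVec_ne_zero K _ _, ?_⟩
  · rw [eq_top_iff, ← (linearIndependent_tangentTensor K).span_eq_top_of_card_eq_finrank'
      (by rw [htensor, Fintype.card_fin]), Submodule.span_le]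
    rintro _ ⟨r, rfl⟩
    exact Submodule.mem_iSup_of_mem (⟨r / 11, by omega⟩ : Fin 23)
      (tangentTensor_mem_segreTangent K r)
  · rintro s ⟨p, hp, htop⟩
    have h := finrank_iSup_segreTangent_le (n := fun _ : Fin 5 => 2) hp
    rw [htop, finrank_top, htensor] at h
    simp only [Finset.sum_const, Finset.card_univ, Fintype.card_fin, smul_eq_mul] at h
    omega
  · apply le_antisymm
    · exact finrank_iSup_segreTangent_le (n := fun _ : Fin 5 => 2)
        fun _ _ => boolVec_pointVec_ne_zero K _ _
    · have hind := (linearIndependent_tangentTensor K).comp (Fin.castLE (by norm_num : 242 ≤ 243))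
        (Fin.castLE_injective _)
      rw [show 22 * 11 = Fintype.card (Fin 242) by simp, ← finrank_span_eq_card hind]
      refine Submodule.finrank_mono (Submodule.span_le.mpr ?_)
      rintro _ ⟨r, rfl⟩
      exact Submodule.mem_iSup_of_mem (⟨r / 11, by omega⟩ : Fin 22)
        (tangentTensor_mem_segreTangent K (Fin.castLE _ r))
end
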